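/- Fix d ≥ 2. There exists a constant C > 0 depending only on the dimension d such that for every n ≥ 1 and every finite set A ⊆ ℤ^d containing B[n], Σ_{y ∈ ∂A} | h_y(0) − (1/b_n) Σ_{x ∈ B[n]} h_y(x) | ≤ C/n, where h_y(x) := P_x(ξ(τ_A) = y) and τ_A = inf{t : ξ(t) ∉ A} is the exit time of the simple random walk ξ from A. -/

import Mathlib

open MeasureTheory Filter
open scoped ENNReal

noncomputable section

/-- The `k`-th binary digit of `x ∈ [0,1)` (after the binary point). -/
def bit (x : ℝ) (k : ℕ) : Bool := ⌊x * 2 ^ (k + 1)⌋ % 2 == 1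

/-- From one uniform sample on `[0,1]`, extract countably many independent uniform
samples on `[0,1]`, using disjoint subsequences of binary digits. -/
def uSlice (x : ℝ) (i : ℕ) : ℝ :=
  ∑' j : ℕ, if bit x (Nat.pair i j) then ((2 : ℝ) ^ (-(j : ℤ) - 1)) else 0

/-- The base probability space: Lebesgue measure restricted to `[0,1]`. -/
def μ0 : Measure ℝ := volume.restrict (Set.Icc 0 1)

/-- The vertex set of the lattice `ℤ^d`. -/
abbrev V (d : ℕ) := Fin d → ℤ

instance (d : ℕ) : MeasurableSpace (Finset (V d)) := ⊤

open Classical in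
/-- `B[r]`: the Euclidean ball of radius `r` in `ℤ^d`, as a `Finset`. -/
def ball (d : ℕ) (r : ℝ) : Finset (V d) :=
  (Finset.Icc (fun _ => -⌈r⌉) (fun _ => ⌈r⌉)).filter
    (fun y => Real.sqrt (∑ i, ((y i : ℝ)) ^ 2) ≤ r)

/-- `b_n`: the number of lattice points in the Euclidean ball of radius `n`. -/
def bn (d n : ℕ) : ℕ := (ball d n).card

/-- The `2d` unit vectors of `ℤ^d` (the possible steps of the simple random walk). -/
def unitVecs (d : ℕ) : Finset (V d) :=
  Finset.image
    (fun p : Fin d × Bool => fun j => if j = p.1 then (if p.2 then 1 else -1) else 0)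
    Finset.univ

/-- Given `u` uniform on `[0,1]`, `pick S u` is a uniformly chosen element of `S`. -/
def pick {d : ℕ} (S : Finset (V d)) (u : ℝ) : V d :=
  if h : S.Nonempty then
    (S.equivFin.symm ⟨(⌊u * S.card⌋).toNat % S.card,
      Nat.mod_lt _ (Finset.card_pos.mpr h)⟩).val
  else 0

/-- Position at time `t` of the simple random walk started at `x`, driven by the
random seed `ω`: the steps `pick (unitVecs d) (uSlice ω i)` are i.i.d. uniform on
the `2d` unit vectors when `ω` is uniform on `[0,1]`. -/
def walk {d : ℕ} (x : V d) (ω : ℝ) (t : ℕ) : V d :=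
  x + ∑ i ∈ Finset.range t, pick (unitVecs d) (uSlice ω i)

/-- `t_S`: the first time the walk started at `x` is outside `S`. -/
def exitT {d : ℕ} (S : Finset (V d)) (x : V d) (ω : ℝ) : ℕ :=
  sInf {t | walk x ω t ∉ S}

/-- The position `ξ(t_S)` at which the walk started at `x` first exits `S`. -/
def hitPt {d : ℕ} (S : Finset (V d)) (x : V d) (ω : ℝ) : V d :=
  walk x ω (exitT S x ω)

/-- `Add[ξ,S]`: add to `S` the exit point of a random walk started at `x`. -/
def addPt {d : ℕ} (S : Finset (V d)) (x : V d) (ω : ℝ) : Finset (V d) :=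
  insert (hitPt S x ω) S

/-- `P_x(ξ(τ_A) = y)`: the probability that the walk started at `x` exits `A` at `y`. -/
def hitProb {d : ℕ} (A : Finset (V d)) (x y : V d) : ℝ≥0∞ :=
  μ0 {ω | hitPt A x ω = y}

/-- The outer boundary `∂A`: vertices outside `A` with a neighbour in `A`. -/
def outb {d : ℕ} (A : Finset (V d)) : Finset (V d) :=
  (A.biUnion fun x => (unitVecs d).image (fun e => x + e)) \ A

/-- `DA_X(S)`: the IDLA aggregate obtained from `S` by launching one particle from each
point of the list `xs` in turn (driven by independent slices of the seed `ω`). -/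
def daFrom {d : ℕ} : Finset (V d) → List (V d) → ℝ → Finset (V d)
  | S, [], _ => S
  | S, x :: xs, ω => daFrom (addPt S x (uSlice ω 0)) xs (uSlice ω 1)

/-- The law of the IDLA aggregate `DA_X(S)`. -/
def daLaw {d : ℕ} (S : Finset (V d)) (xs : List (V d)) : Measure (Finset (V d)) :=
  μ0.map (fun ω => daFrom S xs ω)

/-- One uIDLA step: launch a particle from a uniformly chosen point of `S`. -/
def uStep {d : ℕ} (S : Finset (V d)) (ω : ℝ) : Finset (V d) :=
  addPt S (pick S (uSlice ω 0)) (uSlice ω 1)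

/-- `A_k(S)`: the uIDLA aggregate obtained by adding `k` particles to `S`,
each started at a uniform point of the current aggregate. -/
def uAggFrom {d : ℕ} (S : Finset (V d)) (ω : ℝ) : ℕ → Finset (V d)
  | 0 => S
  | k + 1 => uStep (uAggFrom S ω k) (uSlice ω k)

/-- The law of the uIDLA aggregate `A_k(S)`. -/
def uLaw {d : ℕ} (S : Finset (V d)) (k : ℕ) : Measure (Finset (V d)) :=
  μ0.map (fun ω => uAggFrom S ω k)

/-- One step of the subset uIDLA `A_·(E;m)`: at step `k`, perform a uIDLA step
with probability `|E|/(m+k)` and otherwise do nothing. -/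
def subStep {d : ℕ} (m k : ℕ) (E : Finset (V d)) (ω : ℝ) : Finset (V d) :=
  if uSlice ω 0 * ((m : ℝ) + k) ≤ E.card then uStep E (uSlice ω 1) else E

/-- The subset uIDLA `A_n(E;m)`. -/
def subAggFrom {d : ℕ} (E : Finset (V d)) (m : ℕ) (ω : ℝ) : ℕ → Finset (V d)
  | 0 => E
  | k + 1 => subStep m k (subAggFrom E m ω k) (uSlice ω k)

/-- The law of the subset uIDLA `A_n(E;m)`. -/
def subLaw {d : ℕ} (E : Finset (V d)) (m k : ℕ) : Measure (Finset (V d)) :=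
  μ0.map (fun ω => subAggFrom E m ω k)

/-- Stochastic domination of random finite subsets of `ℤ^d`: `μ` dominates `ν` if
there is a coupling under which the sample of `ν` is a.s. contained in that of `μ`. -/
def StochDom {d : ℕ} (μ ν : Measure (Finset (V d))) : Prop :=
  ∃ π : Measure (Finset (V d) × Finset (V d)), IsProbabilityMeasure π ∧
    π.map Prod.fst = μ ∧ π.map Prod.snd = ν ∧ π {p | p.2 ⊆ p.1} = 1

/-- A `Geometric(1/2)` sample (taking value `j ≥ 0` with probability `2^{-(j+1)}`)
produced from a uniform sample `u` on `[0,1]` by inverting the CDF. -/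
def geom (u : ℝ) : ℕ := sInf {j : ℕ | u ≤ 1 - (2 : ℝ) ^ (-(j : ℤ) - 1)}

/-- The parent of vertex `j ≥ 1` in the uniform random recursive tree (vertex `0` is
the root): uniform on `{0, …, j-1}` when the seed is uniform on `[0,1]`. -/
def parent (ω : ℝ) (j : ℕ) : ℕ := (⌊uSlice ω (Nat.pair 0 j) * j⌋).toNat % j

/-- The reaching time of vertex `j` in a uniform random recursive tree whose edges
carry i.i.d. `Geometric(1/2)` weights: the sum of the weights on the path from the
root to `j`. (The `min` is a.s. inoperative, since a.s. `parent ω (j+1) ≤ j`.) -/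
def reach (ω : ℝ) : ℕ → ℕ
  | 0 => 0
  | j + 1 => reach ω (min (parent ω (j + 1)) j) + geom (uSlice ω (Nat.pair 1 (j + 1)))
termination_by j => j
decreasing_by exact Nat.lt_succ_of_le (min_le_right _ _)

end

open MeasureTheory Filter
open scoped ENNReal

/-- Fair coin measure. -/
noncomputable def coin : Measure Bool :=
  (2⁻¹ : ℝ≥0∞) • Measure.dirac true + (2⁻¹ : ℝ≥0∞) • Measure.dirac false

instance coin_prob : IsProbabilityMeasure coin := by
  constructor
  simp [coin, ENNReal.inv_two_add_inv_two]

instance mu0_prob : IsProbabilityMeasure μ0 := by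
  constructor
  simp [μ0]

lemma mu0_eq : μ0 = volume.restrict (Set.Ico (0:ℝ) 1) := by
  unfold μ0
  exact (Measure.restrict_congr_set Ico_ae_eq_Icc).symm

lemma bit_succ (x : ℝ) (k : ℕ) : bit x (k+1) = bit (2 * x) k := by
  have : x * 2 ^ (k + 1 + 1) = 2 * x * 2 ^ (k + 1) := by ring
  unfold bit
  rw [this]

lemma bit_sub_one (x : ℝ) (k : ℕ) : bit (x - 1) k = bit x k := by
  unfold bit
  have : (x - 1) * 2 ^ (k+1) = x * 2^(k+1) - ((2 ^ (k+1) : ℤ) : ℝ) := by push_cast; ring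
  rw [this, Int.floor_sub_intCast]
  have h : ∀ a : ℤ, (a - 2 ^ (k+1)) % 2 = a % 2 := by
    intro a
    rw [pow_succ]
    omega
  rw [h]

lemma measurable_bit (k : ℕ) : Measurable (fun x => bit x k) := by
  unfold bit
  have : Measurable (fun x : ℝ => ⌊x * 2 ^ (k+1)⌋) := (measurable_id.mul_const _).floor
  exact (Measurable.of_discrete (f := fun z : ℤ => (z % 2 == 1))).comp this

lemma bit_zero_false {x : ℝ} (h0 : 0 ≤ x) (h1 : x < 1/2) : bit x 0 = false := by
  have : ⌊x * 2 ^ (0+1)⌋ = 0 := by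
    rw [Int.floor_eq_iff]; constructor <;> norm_num <;> linarith
  unfold bit
  rw [this]; rfl

lemma bit_zero_true {x : ℝ} (h0 : 1/2 ≤ x) (h1 : x < 1) : bit x 0 = true := by
  have : ⌊x * 2 ^ (0+1)⌋ = 1 := by
    rw [Int.floor_eq_iff]; constructor <;> norm_num <;> linarith
  unfold bit
  rw [this]; rfl

lemma vol_bits (N : ℕ) : ∀ t : ℕ → Set Bool,
    volume {x : ℝ | x ∈ Set.Ico (0:ℝ) 1 ∧ ∀ k < N, bit x k ∈ t k} =
      ∏ k ∈ Finset.range N, coin (t k) := by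
  induction N with
  | zero =>
    intro t
    have : {x : ℝ | x ∈ Set.Ico (0:ℝ) 1 ∧ ∀ k < 0, bit x k ∈ t k} = Set.Ico 0 1 := by
      ext x; simp
    rw [this]; simp
  | succ N ih =>
    intro t
    set E := {x : ℝ | x ∈ Set.Ico (0:ℝ) 1 ∧ ∀ k < N, bit x k ∈ t (k+1)} with hE
    have ihE := ih (fun k => t (k+1))
    have hEm : MeasurableSet E := by
      have : E = Set.Ico (0:ℝ) 1 ∩ ⋂ k ∈ Finset.range N, (fun x => bit x k) ⁻¹' (t (k+1)) := by
        ext x; simp [hE]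
      rw [this]
      exact measurableSet_Ico.inter (Finset.measurableSet_biInter _ fun k _ =>
        measurable_bit k (MeasurableSet.of_discrete))
    rw [Finset.prod_range_succ', ← ihE]
    have hA : volume ((fun x : ℝ => 2 * x) ⁻¹' E) = 2⁻¹ * volume E := by
      rw [Real.volume_preimage_mul_left (by norm_num)]
      congr 1
      rw [abs_of_pos (by norm_num), ENNReal.ofReal_inv_of_pos (by norm_num)]
      simp
    have hC : volume ((fun x : ℝ => x - 1) ⁻¹' E) = volume E := by
      simp only [sub_eq_add_neg]
      exact measure_preimage_add_right volume (-1 : ℝ) E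
    have hB : volume ((fun x : ℝ => 2 * x) ⁻¹' ((fun x => x - 1) ⁻¹' E)) = 2⁻¹ * volume E := by
      rw [Real.volume_preimage_mul_left (by norm_num), hC]
      congr 1
      rw [abs_of_pos (by norm_num), ENNReal.ofReal_inv_of_pos (by norm_num)]
      simp
    have hset : {x : ℝ | x ∈ Set.Ico (0:ℝ) 1 ∧ ∀ k < N+1, bit x k ∈ t k} =
        ((fun x : ℝ => 2 * x) ⁻¹' E ∩ {_x | false ∈ t 0}) ∪
        ((fun x : ℝ => 2 * x) ⁻¹' ((fun x => x - 1) ⁻¹' E) ∩ {_x | true ∈ t 0}) := by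
      ext x
      simp only [Set.mem_ofPred_eq, Set.mem_Ico, Set.mem_union, Set.mem_inter_iff,
        Set.mem_preimage, hE, bit_sub_one, ← bit_succ]
      constructor
      · rintro ⟨⟨h0, h1⟩, h⟩
        rcases lt_or_ge x (1/2) with hx | hx
        · left
          have := h 0 (by omega)
          rw [bit_zero_false h0 hx] at this
          exact ⟨⟨⟨by linarith, by linarith⟩, fun k hk => h (k+1) (by omega)⟩, this⟩
        · right
          have := h 0 (by omega)
          rw [bit_zero_true hx h1] at this
          exact ⟨⟨⟨by linarith, by linarith⟩, fun k hk => h (k+1) (by omega)⟩, this⟩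
      · rintro (⟨⟨⟨h0, h1⟩, h⟩, hf⟩ | ⟨⟨⟨h0, h1⟩, h⟩, hf⟩)
        · refine ⟨⟨by linarith, by linarith⟩, fun k hk => ?_⟩
          rcases k with _ | k
          · rw [bit_zero_false (by linarith) (by linarith)]; exact hf
          · exact h k (by omega)
        · refine ⟨⟨by linarith, by linarith⟩, fun k hk => ?_⟩
          rcases k with _ | k
          · rw [bit_zero_true (by linarith) (by linarith)]; exact hf
          · exact h k (by omega)
    rw [hset, measure_union]
    · rw [← hE]
      have e1 : volume ((fun x : ℝ => 2 * x) ⁻¹' E ∩ {_x | false ∈ t 0}) =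
          2⁻¹ * volume E * (Set.indicator (t 0) 1 false) := by
        by_cases hf : false ∈ t 0
        · simpa [hf] using hA
        · simp [hf]
      have e2 : volume ((fun x : ℝ => 2 * x) ⁻¹' ((fun x => x - 1) ⁻¹' E) ∩ {_x | true ∈ t 0}) =
          2⁻¹ * volume E * (Set.indicator (t 0) 1 true) := by
        by_cases hf : true ∈ t 0
        · simp only [hf, Set.setOf_true, Set.inter_univ, Set.indicator_of_mem, Pi.one_apply, mul_one]
          exact hB
        · simp [hf]
      rw [e1, e2]
      simp only [coin, Measure.add_apply, Measure.smul_apply, smul_eq_mul,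
        Measure.dirac_apply' _ (MeasurableSet.of_discrete)]
      ring
    · rw [Set.disjoint_left]
      rintro x ⟨⟨⟨_, h1⟩, _⟩, _⟩ ⟨⟨⟨h0, _⟩, _⟩, _⟩
      linarith
    · exact (((hEm.preimage (by fun_prop)).preimage (by fun_prop))).inter (by simp)

lemma law_bits : μ0.map (fun ω k => bit ω k) = Measure.infinitePi (fun _ : ℕ => coin) := by
  apply Measure.eq_infinitePi
  intro s t ht
  classical
  obtain ⟨N, hN⟩ : ∃ N, s ⊆ Finset.range N := Finset.exists_nat_subset_range s
  have hm : Measurable (fun ω (k : ℕ) => bit ω k) := measurable_pi_iff.2 measurable_bit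
  have hpm : MeasurableSet (Set.pi (s : Set ℕ) t) :=
    MeasurableSet.pi s.countable_toSet fun i _ => ht i
  rw [Measure.map_apply hm hpm, mu0_eq, Measure.restrict_apply (hm hpm)]
  have := vol_bits N (fun k => if k ∈ s then t k else Set.univ)
  convert this using 1
  · congr 1
    ext x
    simp only [Set.mem_inter_iff, Set.mem_preimage, Set.mem_pi, Finset.mem_coe, Set.mem_ofPred_eq]
    constructor
    · rintro ⟨h1, h2⟩
      refine ⟨h2, fun k _ => ?_⟩
      split_ifs with hk
      · exact h1 k hk
      · trivial
    · rintro ⟨h1, h2⟩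
      refine ⟨fun k hk => ?_, h1⟩
      have := h2 k (Finset.mem_range.1 (hN hk))
      simpa [hk] using this
  · rw [← Finset.prod_subset hN]
    · exact Finset.prod_congr rfl fun k hk => by simp [hk]
    · intro k _ hk; rw [if_neg hk]; exact measure_univ

/-- Binary expansion. -/
noncomputable def binExp (b : ℕ → Bool) : ℝ :=
  ∑' j : ℕ, if b j then ((2 : ℝ) ^ (-(j : ℤ) - 1)) else 0

lemma zpow_form (j : ℕ) : ((2 : ℝ) ^ (-(j : ℤ) - 1)) = ((2:ℝ) ^ (j+1))⁻¹ := by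
  rw [← zpow_natCast, ← zpow_neg]; congr 1; push_cast; ring

lemma measurable_binExp : Measurable binExp := by
  have : Continuous binExp := by
    unfold binExp
    refine continuous_tsum (u := fun j : ℕ => ((2:ℝ) ^ (j+1))⁻¹) ?_ ?_ ?_
    · intro j
      exact (continuous_of_discreteTopology
        (f := fun c : Bool => if c then ((2 : ℝ) ^ (-(j : ℤ) - 1)) else 0)).comp (continuous_apply j)
    · have := (summable_geometric_of_lt_one (r := (2:ℝ)⁻¹) (by norm_num) (by norm_num)).mul_right (2:ℝ)⁻¹
      refine this.congr fun j => ?_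
      rw [pow_succ, mul_inv, inv_pow]
    · intro j b
      rw [zpow_form]
      split_ifs
      · rw [Real.norm_of_nonneg (by positivity)]
      · simp; 
  exact this.measurable

lemma binExp_bits {x : ℝ} (hx : x ∈ Set.Ico (0:ℝ) 1) : binExp (fun k => bit x k) = x := by
  have := (Real.hasSum_ofDigitsTerm_digits x (b := 2) (by norm_num) hx).tsum_eq
  conv_rhs => rw [← this]
  unfold binExp
  congr 1
  ext j
  rw [zpow_form]
  have hb : (fun k => bit x k) j = (⌊x * 2 ^ (j + 1)⌋ % 2 == 1) := rfl
  rw [hb]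
  simp only [Real.ofDigitsTerm, Real.digits]
  have h0 : 0 ≤ x * 2 ^ (j+1) := mul_nonneg hx.1 (by positivity)
  have hfl : ⌊x * 2 ^ (j+1)⌋ = (⌊x * 2 ^ (j+1)⌋₊ : ℤ) := (Int.natCast_floor_eq_floor h0).symm
  rw [hfl]
  simp only [Nat.cast_ofNat, Fin.ofNat]
  rcases Nat.mod_two_eq_zero_or_one ⌊x * 2 ^ (j+1)⌋₊ with h | h
  · have h' : ((⌊x * 2 ^ (j+1)⌋₊ : ℤ) % 2) = 0 := by omega
    simp [h, h']
  · have h' : ((⌊x * 2 ^ (j+1)⌋₊ : ℤ) % 2) = 1 := by omega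
    simp [h, h']

lemma law_binExp : (Measure.infinitePi (fun _ : ℕ => coin)).map binExp = μ0 := by
  have hm : Measurable (fun ω (k : ℕ) => bit ω k) := measurable_pi_iff.2 measurable_bit
  rw [← law_bits, Measure.map_map measurable_binExp hm]
  conv_rhs => rw [← Measure.map_id (μ := μ0)]
  apply Measure.map_congr
  rw [mu0_eq]
  filter_upwards [ae_restrict_mem measurableSet_Ico] with x hx
  exact binExp_bits hx

lemma law_uSlice : μ0.map (fun ω i => uSlice ω i) = Measure.infinitePi (fun _ : ℕ => μ0) := by
  have hm : Measurable (fun ω (k : ℕ) => bit ω k) := measurable_pi_iff.2 measurable_bit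
  have h1 : (fun ω i => uSlice ω i) =
      (fun (b : ℕ → ℕ → Bool) i => binExp (b i)) ∘ (MeasurableEquiv.curry ℕ ℕ Bool) ∘
      (fun (b : ℕ → Bool) (p : ℕ × ℕ) => b (Nat.pair p.1 p.2)) ∘ (fun ω k => bit ω k) := by
    rfl
  have hinj : Function.Injective (fun p : ℕ × ℕ => Nat.pair p.1 p.2) := by
    intro p q h
    have := Nat.pair_eq_pair.1 h
    exact Prod.ext this.1 this.2
  have m1 : Measurable (fun (b : ℕ → Bool) (p : ℕ × ℕ) => b (Nat.pair p.1 p.2)) := by fun_prop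
  have m3 : Measurable (fun (b : ℕ → ℕ → Bool) i => binExp (b i)) :=
    measurable_pi_iff.2 fun i => measurable_binExp.comp (measurable_pi_apply i)
  rw [h1, ← Measure.map_map m3 (by fun_prop), ← Measure.map_map (by fun_prop) (by fun_prop),
    ← Measure.map_map m1 hm, law_bits, Measure.map_infinitePi_infinitePi_of_inj hinj]
  rw [Measure.infinitePi_map_curry (fun _ _ => coin),
    Measure.infinitePi_map_pi _ (fun _ => measurable_binExp), law_binExp]

lemma measurable_uSlice (i : ℕ) : Measurable (fun ω => uSlice ω i) := by
  have hm : Measurable (fun ω (j : ℕ) => bit ω (Nat.pair i j)) :=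
    measurable_pi_iff.2 fun j => measurable_bit _
  exact measurable_binExp.comp hm


open MeasureTheory Filter
open scoped ENNReal

lemma measurable_pick {d : ℕ} (S : Finset (V d)) : Measurable (pick S) := by
  by_cases h : S.Nonempty
  · have : pick S = (fun z : ℤ => (S.equivFin.symm ⟨z.toNat % S.card,
      Nat.mod_lt _ (Finset.card_pos.mpr h)⟩).val) ∘ (fun u : ℝ => ⌊u * S.card⌋) := by
      ext u : 1
      simp [pick, h]
    rw [this]
    exact Measurable.of_discrete.comp (measurable_id.mul_const _).floor
  · have : pick S = fun _ => 0 := by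
      ext u : 1
      simp [pick, h]
    rw [this]; exact measurable_const

lemma law_pick {d : ℕ} (S : Finset (V d)) {e : V d} (he : e ∈ S) :
    (μ0.map (pick S)) {e} = ENNReal.ofReal (1 / S.card) := by
  have hS : S.Nonempty := ⟨e, he⟩
  have hN : 0 < S.card := Finset.card_pos.mpr hS
  have hN' : (0:ℝ) < S.card := by exact_mod_cast hN
  rw [Measure.map_apply (measurable_pick S) (measurableSet_singleton e), mu0_eq,
    Measure.restrict_apply (measurable_pick S (measurableSet_singleton e))]
  set k := S.equivFin ⟨e, he⟩ with hk
  have hk1 : ((k : ℕ) : ℝ) + 1 ≤ S.card := by exact_mod_cast k.2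
  have hset : pick S ⁻¹' {e} ∩ Set.Ico (0:ℝ) 1 =
      Set.Ico ((k : ℕ) / (S.card : ℝ)) (((k : ℕ) + 1) / (S.card : ℝ)) := by
    ext u
    simp only [Set.mem_inter_iff, Set.mem_preimage, Set.mem_singleton_iff, Set.mem_Ico]
    have key : 0 ≤ u → u < 1 → (pick S u = e ↔ ⌊u * S.card⌋ = (k : ℕ)) := by
      intro h0 h1
      have hf0 : 0 ≤ ⌊u * S.card⌋ := Int.floor_nonneg.2 (by positivity)
      have hf1 : ⌊u * S.card⌋ < S.card := by
        rw [Int.floor_lt]; push_cast; nlinarith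
      have hmod : (⌊u * S.card⌋).toNat % S.card = (⌊u * S.card⌋).toNat :=
        Nat.mod_eq_of_lt (by omega)
      have : pick S u = e ↔ (⟨(⌊u * S.card⌋).toNat % S.card,
          Nat.mod_lt _ (Finset.card_pos.mpr hS)⟩ : Fin S.card) = k := by
        simp only [pick, hS, dite_true]
        rw [hk, ← Equiv.symm_apply_eq, Subtype.ext_iff]
      rw [this, Fin.ext_iff]
      simp only [hmod]
      omega
    constructor
    · rintro ⟨h, h0, h1⟩
      rw [key h0 h1, Int.floor_eq_iff] at h
      rw [div_le_iff₀ hN', lt_div_iff₀ hN']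
      exact_mod_cast h
    · rintro ⟨h0, h1⟩
      have hu0 : 0 ≤ u := le_trans (by positivity) h0
      have hu1 : u < 1 := lt_of_lt_of_le h1 (by rw [div_le_one hN']; exact hk1)
      refine ⟨?_, hu0, hu1⟩
      rw [key hu0 hu1, Int.floor_eq_iff]
      rw [div_le_iff₀ hN'] at h0
      rw [lt_div_iff₀ hN'] at h1
      constructor
      · exact_mod_cast h0
      · exact_mod_cast h1
  rw [hset, Real.volume_Ico]
  congr 1
  ring

/-- Law of the step. -/
noncomputable def stepLaw (d : ℕ) : Measure (V d) := μ0.map (pick (unitVecs d))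

instance stepLaw_prob (d : ℕ) : IsProbabilityMeasure (stepLaw d) :=
  Measure.isProbabilityMeasure_map (measurable_pick _).aemeasurable

/-- Law of the sequence of steps. -/
noncomputable def seqLaw (d : ℕ) : Measure (ℕ → V d) := Measure.infinitePi (fun _ => stepLaw d)

instance seqLaw_prob (d : ℕ) : IsProbabilityMeasure (seqLaw d) := by
  unfold seqLaw; infer_instance

/-- steps -/
noncomputable def stepsOf (d : ℕ) (ω : ℝ) : ℕ → V d := fun i => pick (unitVecs d) (uSlice ω i)

lemma measurable_stepsOf (d : ℕ) : Measurable (stepsOf d) :=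
  measurable_pi_iff.2 fun i => (measurable_pick _).comp (measurable_uSlice i)

lemma law_steps (d : ℕ) : μ0.map (stepsOf d) = seqLaw d := by
  have h1 : stepsOf d = (fun (x : ℕ → ℝ) i => pick (unitVecs d) (x i)) ∘
      (fun ω i => uSlice ω i) := rfl
  have m3 : Measurable (fun (x : ℕ → ℝ) i => pick (unitVecs d) (x i)) :=
    measurable_pi_iff.2 fun i => (measurable_pick _).comp (measurable_pi_apply i)
  rw [h1, ← Measure.map_map m3 (measurable_pi_iff.2 measurable_uSlice), law_uSlice,
    Measure.infinitePi_map_pi _ (fun _ => measurable_pick _)]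
  rfl

/-- prepend -/
def seqCons {d : ℕ} (p : V d × (ℕ → V d)) : ℕ → V d
  | 0 => p.1
  | n + 1 => p.2 n

lemma measurable_seqCons {d : ℕ} : Measurable (seqCons (d := d)) := by
  rw [measurable_pi_iff]
  intro n
  cases n with
  | zero => exact measurable_fst
  | succ n => exact (measurable_pi_apply n).comp measurable_snd

lemma law_cons (d : ℕ) : ((stepLaw d).prod (seqLaw d)).map seqCons = seqLaw d := by
  apply Measure.eq_infinitePi
  intro s t ht
  classical
  obtain ⟨N, hN⟩ : ∃ N, s ⊆ Finset.range N := Finset.exists_nat_subset_range s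
  have hN' : s ⊆ Finset.range (N+1) := hN.trans (Finset.range_mono (by omega))
  set t2 : ℕ → Set (V d) := fun k => if k ∈ s then t k else Set.univ with ht2
  have ht2m : ∀ k, MeasurableSet (t2 k) := by
    intro k; simp only [ht2]; split_ifs
    · exact ht k
    · exact MeasurableSet.univ
  rw [Measure.map_apply measurable_seqCons (MeasurableSet.pi s.countable_toSet fun i _ => ht i)]
  have hpre : seqCons ⁻¹' (Set.pi (s : Set ℕ) t) =
      (t2 0) ×ˢ (Set.pi (Finset.range N : Set ℕ) (fun k => t2 (k+1))) := by
    ext ⟨a, x⟩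
    simp only [Set.mem_preimage, Set.mem_pi, Finset.mem_coe, Set.mem_prod, Finset.mem_range]
    constructor
    · intro h
      refine ⟨?_, fun k _ => ?_⟩
      · simp only [ht2]; split_ifs with h0
        · exact h 0 h0
        · trivial
      · simp only [ht2]; split_ifs with h0
        · exact h (k+1) h0
        · trivial
    · rintro ⟨h0, h1⟩ k hk
      cases k with
      | zero =>
        have h0' : a ∈ t 0 := by simpa [ht2, hk] using h0
        exact h0'
      | succ k =>
        have := Finset.mem_range.1 (hN' hk)
        have := h1 k (by omega)
        have h1' : x k ∈ t (k+1) := by simpa [ht2, hk] using this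
        exact h1'
  have hprod : ∏ k ∈ s, stepLaw d (t k) = ∏ k ∈ Finset.range (N+1), stepLaw d (t2 k) := by
    rw [← Finset.prod_subset hN']
    · exact Finset.prod_congr rfl fun k hk => by simp [ht2, hk]
    · intro k _ hk; simp only [ht2]; rw [if_neg hk]; exact measure_univ
  rw [hpre, Measure.prod_prod, hprod, Finset.prod_range_succ', mul_comm]
  congr 1
  exact Measure.infinitePi_pi _ (fun i _ => ht2m _)

/-- walk along a step sequence -/
def sWalk {d : ℕ} (x : V d) (s : ℕ → V d) (t : ℕ) : V d := x + ∑ i ∈ Finset.range t, s i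

/-- exit point along a step sequence -/
noncomputable def sHit {d : ℕ} (A : Finset (V d)) (x : V d) (s : ℕ → V d) : V d :=
  sWalk x s (sInf {t | sWalk x s t ∉ A})

lemma hitPt_eq {d : ℕ} (A : Finset (V d)) (x : V d) (ω : ℝ) :
    hitPt A x ω = sHit A x (stepsOf d ω) := rfl

lemma sHit_iff {d : ℕ} {A : Finset (V d)} {x y : V d} (hy : y ∉ A) (s : ℕ → V d) :
    sHit A x s = y ↔ ∃ t, (∀ k < t, sWalk x s k ∈ A) ∧ sWalk x s t = y := by
  constructor
  · intro h
    refine ⟨_, fun k hk => ?_, h⟩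
    have := Nat.notMem_of_lt_sInf hk
    simpa using this
  · rintro ⟨t, h1, h2⟩
    have : sInf {t | sWalk x s t ∉ A} = t := by
      apply le_antisymm
      · apply Nat.sInf_le
        show sWalk x s t ∉ A
        rw [h2]; exact hy
      · apply le_csInf ⟨t, by show sWalk x s t ∉ A; rw [h2]; exact hy⟩
        intro k hk
        by_contra hlt
        exact hk (h1 k (by omega))
    unfold sHit
    rw [this, h2]

lemma sWalk_succ {d : ℕ} (x : V d) (p : V d × (ℕ → V d)) (t : ℕ) :
    sWalk x (seqCons p) (t+1) = sWalk (x + p.1) p.2 t := by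
  unfold sWalk
  rw [Finset.sum_range_succ']
  simp only [seqCons]
  abel

lemma sHit_cons {d : ℕ} {A : Finset (V d)} {x y : V d} (hx : x ∈ A) (hy : y ∉ A)
    (p : V d × (ℕ → V d)) :
    sHit A x (seqCons p) = y ↔ sHit A (x + p.1) p.2 = y := by
  rw [sHit_iff hy, sHit_iff hy]
  constructor
  · rintro ⟨t, h1, h2⟩
    cases t with
    | zero =>
      exfalso
      apply hy
      rw [← h2]
      simpa [sWalk] using hx
    | succ t =>
      refine ⟨t, fun k hk => ?_, ?_⟩
      · rw [← sWalk_succ]; exact h1 (k+1) (by omega)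
      · rw [← sWalk_succ]; exact h2
  · rintro ⟨t, h1, h2⟩
    refine ⟨t+1, fun k hk => ?_, ?_⟩
    · cases k with
      | zero => simpa [sWalk] using hx
      | succ k => rw [sWalk_succ]; exact h1 k (by omega)
    · rw [sWalk_succ]; exact h2

lemma measurable_sWalk {d : ℕ} (x : V d) (t : ℕ) : Measurable (fun s => sWalk x s t) := by
  unfold sWalk
  have : Measurable (fun s : ℕ → V d => ∑ i ∈ Finset.range t, s i) :=
    Finset.measurable_fun_sum _ fun i _ => measurable_pi_apply i
  exact (Measurable.of_discrete (f := fun v : V d => x + v)).comp this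

lemma measurableSet_sHit {d : ℕ} {A : Finset (V d)} {x y : V d} (hy : y ∉ A) :
    MeasurableSet {s | sHit A x s = y} := by
  have : {s | sHit A x s = y} = ⋃ t, ((⋂ k ∈ Finset.range t, (fun s => sWalk x s k) ⁻¹' (A : Set (V d))) ∩
      (fun s => sWalk x s t) ⁻¹' {y}) := by
    ext s
    simp [sHit_iff hy]
  rw [this]
  refine MeasurableSet.iUnion fun t => ?_
  refine (Finset.measurableSet_biInter _ fun k _ => ?_).inter ?_
  · exact measurable_sWalk x k (Finset.measurableSet _)
  · exact measurable_sWalk x t (measurableSet_singleton y)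

lemma hitProb_eq {d : ℕ} {A : Finset (V d)} {x y : V d} (hy : y ∉ A) :
    hitProb A x y = seqLaw d {s | sHit A x s = y} := by
  rw [← law_steps, Measure.map_apply (measurable_stepsOf d) (measurableSet_sHit hy)]
  rfl

lemma mem_unitVecs_pick {d : ℕ} (hd : 0 < d) (u : ℝ) : pick (unitVecs d) u ∈ unitVecs d := by
  have : (unitVecs d).Nonempty := by
    have : Nonempty (Fin d) := ⟨⟨0, hd⟩⟩
    exact Finset.image_nonempty.2 Finset.univ_nonempty
  simp only [pick, this, dite_true]
  exact Subtype.property _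

/-- real hitting probability -/
noncomputable def hr {d : ℕ} (A : Finset (V d)) (y x : V d) : ℝ := (hitProb A x y).toReal

lemma hitProb_step {d : ℕ} (hd : 0 < d) {A : Finset (V d)} {x y : V d} (hx : x ∈ A) (hy : y ∉ A) :
    hitProb A x y =
      ∑ e ∈ unitVecs d, ENNReal.ofReal (1 / (unitVecs d).card) * hitProb A (x + e) y := by
  rw [hitProb_eq hy]
  have hms := measurableSet_sHit (A := A) (x := x) hy
  rw [← law_cons, Measure.map_apply measurable_seqCons hms]
  have h0 : (stepLaw d) ((unitVecs d : Set (V d))ᶜ) = 0 := by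
    unfold stepLaw
    rw [Measure.map_apply (measurable_pick _) (Finset.measurableSet _).compl]
    convert measure_empty (μ := μ0)
    ext u
    simp [mem_unitVecs_pick hd u]
  have hset : seqCons ⁻¹' {s | sHit A x s = y} =
      (⋃ e ∈ unitVecs d, ({e} : Set (V d)) ×ˢ {s | sHit A (x + e) s = y}) ∪
      (((unitVecs d : Set (V d))ᶜ ×ˢ Set.univ) ∩ seqCons ⁻¹' {s | sHit A x s = y}) := by
    ext ⟨a, s⟩
    by_cases ha : a ∈ unitVecs d
    · simp [sHit_cons hx hy, ha]
    · simp [sHit_cons hx hy, ha]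
  have hnull : ((stepLaw d).prod (seqLaw d))
      (((unitVecs d : Set (V d))ᶜ ×ˢ Set.univ) ∩ seqCons ⁻¹' {s | sHit A x s = y}) = 0 := by
    refine measure_mono_null Set.inter_subset_left ?_
    rw [Measure.prod_prod, h0, zero_mul]
  have hun : ∀ S : Set (V d × (ℕ → V d)), ((stepLaw d).prod (seqLaw d)) (S ∪
      (((unitVecs d : Set (V d))ᶜ ×ˢ Set.univ) ∩ seqCons ⁻¹' {s | sHit A x s = y})) =
      ((stepLaw d).prod (seqLaw d)) S := fun S =>
    le_antisymm ((measure_union_le _ _).trans (by rw [hnull, add_zero]))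
      (measure_mono Set.subset_union_left)
  rw [hset, hun, measure_biUnion_finset]
  · refine Finset.sum_congr rfl fun e he => ?_
    rw [Measure.prod_prod, hitProb_eq hy]
    congr 1
    exact law_pick _ he
  · intro e _ e' _ hne
    simp only [Function.onFun]
    rw [Set.disjoint_left]
    rintro ⟨a, s⟩ ⟨h1, _⟩ ⟨h2, _⟩
    exact hne (h1.symm.trans h2)
  · intro e _
    exact (measurableSet_singleton e).prod (measurableSet_sHit hy)


open MeasureTheory Filter
open scoped ENNReal

/-- unit vector -/
def ev {d : ℕ} (i : Fin d) : V d := Pi.single i 1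

lemma ev_same {d : ℕ} (i : Fin d) : ev i i = 1 := by simp [ev]
lemma ev_ne {d : ℕ} {i j : Fin d} (h : j ≠ i) : ev i j = 0 := by simp [ev, h]

lemma unitVecs_inj (d : ℕ) : Function.Injective
    (fun p : Fin d × Bool => (fun j => if j = p.1 then (if p.2 then 1 else -1) else 0 : V d)) := by
  rintro ⟨i, b⟩ ⟨j, c⟩ h
  have hij : i = j := by
    by_contra hne
    have := congrFun h i
    simp only [if_true, if_neg hne] at this
    cases b <;> simp at this
  subst hij
  have := congrFun h i
  cases b <;> cases c <;> simp at this ⊢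

lemma card_unitVecs (d : ℕ) : (unitVecs d).card = 2 * d := by
  unfold unitVecs
  rw [Finset.card_image_of_injective _ (unitVecs_inj d)]
  simp [mul_comm]

lemma sum_unitVecs {d : ℕ} (f : V d → ℝ) :
    ∑ e ∈ unitVecs d, f e = ∑ i : Fin d, (f (ev i) + f (- ev i)) := by
  unfold unitVecs
  rw [Finset.sum_image (fun a _ b _ h => unitVecs_inj d h), Fintype.sum_prod_type]
  refine Finset.sum_congr rfl fun i _ => ?_
  rw [Fintype.sum_bool]
  congr 2
  · ext j; by_cases h : j = i
    · subst h; simp [ev]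
    · simp [ev, h]
  · ext j; by_cases h : j = i
    · subst h; simp [ev]
    · simp [ev, h]

/-- discrete Laplacian (unnormalised) -/
def Lap {d : ℕ} (f : V d → ℝ) (x : V d) : ℝ :=
  ∑ i : Fin d, (f (x + ev i) + f (x - ev i) - 2 * f x)

lemma hitProb_le_one {d : ℕ} (A : Finset (V d)) (x y : V d) : hitProb A x y ≤ 1 := prob_le_one

lemma Lap_hr {d : ℕ} (hd : 0 < d) {A : Finset (V d)} {x y : V d} (hx : x ∈ A) (hy : y ∉ A) :
    Lap (hr A y) x = 0 := by
  have h := congrArg ENNReal.toReal (hitProb_step hd hx hy)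
  have hd' : (0:ℝ) < d := by exact_mod_cast hd
  rw [ENNReal.toReal_sum (fun e _ => ENNReal.mul_ne_top ENNReal.ofReal_ne_top
    (ne_top_of_le_ne_top ENNReal.one_ne_top (hitProb_le_one _ _ _)))] at h
  simp only [ENNReal.toReal_mul] at h
  rw [sum_unitVecs (fun e => (ENNReal.ofReal (1 / ((unitVecs d).card : ℝ))).toReal *
    (hitProb A (x + e) y).toReal), card_unitVecs, ENNReal.toReal_ofReal (by positivity)] at h
  unfold Lap
  rw [Finset.sum_sub_distrib]
  simp only [← mul_add, ← Finset.mul_sum] at h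
  simp only [hr, sub_eq_add_neg x, h, Finset.sum_const, Finset.card_univ, Fintype.card_fin]
  push_cast
  simp only [nsmul_eq_mul]
  field_simp
  ring

lemma hr_sum_le {d : ℕ} (A : Finset (V d)) (x : V d) : ∑ y ∈ outb A, hr A y x ≤ 1 := by
  have hout : ∀ y ∈ outb A, y ∉ A := fun y hy => (Finset.mem_sdiff.1 hy).2
  unfold hr
  rw [← ENNReal.toReal_sum (fun e _ =>
    (ne_top_of_le_ne_top ENNReal.one_ne_top (hitProb_le_one _ _ _)))]
  rw [Finset.sum_congr rfl fun y hy => hitProb_eq (x := x) (hout y hy)]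
  rw [← measure_biUnion_finset]
  · calc _ ≤ (1 : ℝ≥0∞).toReal := ENNReal.toReal_mono ENNReal.one_ne_top prob_le_one
      _ = 1 := by simp
  · intro y _ y' _ hne
    simp only [Function.onFun]
    rw [Set.disjoint_left]
    intro s h1 h2
    exact hne (h1.symm.trans h2)
  · intro y hy
    exact measurableSet_sHit (hout y hy)

lemma hr_nonneg {d : ℕ} (A : Finset (V d)) (y x : V d) : 0 ≤ hr A y x := ENNReal.toReal_nonneg

lemma statement4_of_det (d : ℕ) (hd : 2 ≤ d)
    (H : ∃ C : ℝ, 0 < C ∧ ∀ n : ℕ, 1 ≤ n → ∀ h : V d → ℝ, (∀ x, |h x| ≤ 1) →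
      (∀ x ∈ ball d n, Lap h x = 0) →
      |h 0 - (1 / (bn d n : ℝ)) * ∑ x ∈ ball d n, h x| ≤ C / n) :
    ∃ C : ℝ, 0 < C ∧ ∀ n : ℕ, 1 ≤ n → ∀ A : Finset (V d), ball d n ⊆ A →
      ∑ y ∈ outb A,
        |(hitProb A 0 y).toReal -
          (1 / (bn d n : ℝ)) * ∑ x ∈ ball d n, (hitProb A x y).toReal| ≤ C / n := by
  obtain ⟨C, hC, H⟩ := H
  refine ⟨C, hC, fun n hn A hA => ?_⟩
  have hout : ∀ y ∈ outb A, y ∉ A := fun y hy => (Finset.mem_sdiff.1 hy).2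
  set D : V d → ℝ := fun y => hr A y 0 - (1 / (bn d n : ℝ)) * ∑ x ∈ ball d n, hr A y x with hD
  set σ : V d → ℝ := fun y => if 0 ≤ D y then 1 else -1 with hσ
  have hσabs : ∀ y, |σ y| = 1 := by
    intro y; simp only [hσ]; split_ifs <;> simp
  have hσD : ∀ y, |D y| = σ y * D y := by
    intro y; simp only [hσ]; split_ifs with h
    · rw [abs_of_nonneg h, one_mul]
    · rw [abs_of_neg (not_le.1 h)]; ring
  have key := H n hn (fun x => ∑ y ∈ outb A, σ y * hr A y x) ?_ ?_
  · refine le_trans (le_of_eq ?_) (le_trans (le_abs_self _) key)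
    show ∑ y ∈ outb A, |D y| = _
    simp only [hσD]
    rw [Finset.sum_comm, Finset.mul_sum, ← Finset.sum_sub_distrib]
    refine Finset.sum_congr rfl fun y _ => ?_
    rw [← Finset.mul_sum]
    simp only [hD]
    ring
  · intro x
    refine (Finset.abs_sum_le_sum_abs _ _).trans (le_trans (le_of_eq ?_) (hr_sum_le A x))
    refine Finset.sum_congr rfl fun y _ => ?_
    rw [abs_mul, hσabs, one_mul, abs_of_nonneg (hr_nonneg _ _ _)]
  · intro x hx
    have : Lap (fun x => ∑ y ∈ outb A, σ y * hr A y x) x =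
        ∑ y ∈ outb A, σ y * Lap (hr A y) x := by
      unfold Lap
      simp only [Finset.mul_sum, ← Finset.sum_add_distrib, ← Finset.sum_sub_distrib]
      rw [Finset.sum_comm]
      refine Finset.sum_congr rfl fun y _ => Finset.sum_congr rfl fun i _ => ?_
      ring
    rw [this]
    refine Finset.sum_eq_zero fun y hy => ?_
    rw [Lap_hr (by omega) (hA hx) (hout y hy), mul_zero]


open MeasureTheory Filter
open scoped ENNReal

/-- squared Euclidean norm -/
def sqn {d : ℕ} (x : V d) : ℝ := ∑ i, ((x i : ℝ)) ^ 2

lemma sqn_nonneg {d : ℕ} (x : V d) : 0 ≤ sqn x := Finset.sum_nonneg fun _ _ => sq_nonneg _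

lemma coord_sq_le {d : ℕ} (x : V d) (i : Fin d) : (x i : ℝ) ^ 2 ≤ sqn x :=
  Finset.single_le_sum (f := fun i => (x i : ℝ) ^ 2) (fun _ _ => sq_nonneg _) (Finset.mem_univ i)

lemma sqn_add {d : ℕ} (x : V d) (i : Fin d) (k : ℤ) :
    sqn (x + k • ev i) = sqn x + 2 * k * x i + k ^ 2 := by
  unfold sqn
  rw [← Finset.add_sum_erase _ _ (Finset.mem_univ i),
    ← Finset.add_sum_erase (a := i) _ (fun i => (x i : ℝ) ^ 2) (Finset.mem_univ i)]
  have : ∑ j ∈ Finset.univ.erase i, (((x + k • ev i) j : ℤ) : ℝ) ^ 2 =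
      ∑ j ∈ Finset.univ.erase i, (x j : ℝ) ^ 2 := by
    refine Finset.sum_congr rfl fun j hj => ?_
    simp [ev_ne (Finset.ne_of_mem_erase hj)]
  rw [this]
  simp [ev_same]
  ring

lemma sqn_add_one {d : ℕ} (x : V d) (i : Fin d) : sqn (x + ev i) = sqn x + 2 * x i + 1 := by
  have := sqn_add x i 1
  simpa using this

lemma sqn_sub_one {d : ℕ} (x : V d) (i : Fin d) : sqn (x - ev i) = sqn x - 2 * x i + 1 := by
  have := sqn_add x i (-1)
  simp at this
  rw [sub_eq_add_neg, this]; ring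

lemma mem_ball_iff {d : ℕ} (n : ℕ) (y : V d) : y ∈ ball d n ↔ sqn y ≤ (n:ℝ) ^ 2 := by
  unfold ball
  rw [Finset.mem_filter, Finset.mem_Icc, Real.sqrt_le_left (by positivity)]
  constructor
  · exact fun h => h.2
  · intro h
    have hi : ∀ i, -(n:ℤ) ≤ y i ∧ y i ≤ n := by
      intro i
      have h1 : (y i : ℝ)^2 ≤ (n:ℝ)^2 := (coord_sq_le y i).trans h
      have := abs_le_of_sq_le_sq' h1 (by positivity)
      exact ⟨by exact_mod_cast this.1, by exact_mod_cast this.2⟩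
    refine ⟨⟨fun i => ?_, fun i => ?_⟩, h⟩
    · simpa using (hi i).1
    · simpa using (hi i).2

/-- reflection `x_i ↦ 1 - x_i` -/
def refl1 {d : ℕ} (i : Fin d) (x : V d) : V d := Function.update x i (1 - x i)

lemma refl1_same {d : ℕ} (i : Fin d) (x : V d) : refl1 i x i = 1 - x i := by simp [refl1]
lemma refl1_ne {d : ℕ} {i j : Fin d} (h : j ≠ i) (x : V d) : refl1 i x j = x j := by
  simp [refl1, h]

lemma refl1_refl1 {d : ℕ} (i : Fin d) (x : V d) : refl1 i (refl1 i x) = x := by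
  ext j; by_cases h : j = i
  · subst h; simp [refl1_same]
  · simp [refl1_ne h]

lemma refl1_add_ne {d : ℕ} {i j : Fin d} (h : j ≠ i) (x : V d) :
    refl1 i (x + ev j) = refl1 i x + ev j ∧ refl1 i (x - ev j) = refl1 i x - ev j := by
  constructor <;>
  · ext k; by_cases hk : k = i
    · subst hk; simp [refl1_same, ev_ne (Ne.symm h)]
    · simp [refl1_ne hk]

lemma refl1_add_same {d : ℕ} (i : Fin d) (x : V d) :
    refl1 i (x + ev i) = refl1 i x - ev i ∧ refl1 i (x - ev i) = refl1 i x + ev i := by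
  constructor <;>
  · ext k; by_cases hk : k = i
    · subst hk; simp only [refl1_same, ev_same, Pi.add_apply, Pi.sub_apply]; ring
    · simp [refl1_ne hk, ev_ne hk]

lemma Lap_refl1 {d : ℕ} (i : Fin d) (h : V d → ℝ) (x : V d) :
    Lap (fun x => h (refl1 i x)) x = Lap h (refl1 i x) := by
  unfold Lap
  refine Finset.sum_congr rfl fun j _ => ?_
  beta_reduce
  by_cases hj : j = i
  · subst hj
    rw [(refl1_add_same j x).1, (refl1_add_same j x).2]; ring
  · rw [(refl1_add_ne hj x).1, (refl1_add_ne hj x).2]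

/-- the barrier -/
noncomputable def barr {d : ℕ} (i : Fin d) (M : ℝ) (x : V d) : ℝ :=
  2 * (sqn x + (d + 1) * (x i * (M - x i))) / M ^ 2

lemma Lap_barr {d : ℕ} (i : Fin d) {M : ℝ} (hM : 0 < M) (x : V d) :
    Lap (barr i M) x = - 4 / M ^ 2 := by
  unfold Lap
  have : ∀ j, barr i M (x + ev j) + barr i M (x - ev j) - 2 * barr i M x =
      4 / M ^ 2 + (if j = i then - 4 * (d + 1) / M ^ 2 else 0) := by
    intro j
    unfold barr
    rw [sqn_add_one, sqn_sub_one]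
    split_ifs with h
    · subst h
      simp only [Pi.add_apply, Pi.sub_apply, ev_same]
      push_cast
      field_simp
      ring
    · simp only [Pi.add_apply, Pi.sub_apply, ev_ne (Ne.symm h)]
      push_cast
      field_simp
      ring
  rw [Finset.sum_congr rfl fun j _ => this j, Finset.sum_add_distrib]
  simp
  field_simp
  ring

lemma grad_aux {d : ℕ} (h : V d → ℝ) (hb : ∀ x, |h x| ≤ 1) (m : ℕ) (hm : 1 ≤ m) (i : Fin d)
    (hh : ∀ x : V d, (∀ j, |x j| ≤ m) → Lap h x = 0) :
    h (ev i) - h 0 ≤ 2 * (d + 1) / (m + 1) := by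
  set M : ℝ := m + 1 with hM
  have hMpos : 0 < M := by positivity
  set f : V d → ℝ := fun x => h x - h (refl1 i x) with hf
  have hf2 : ∀ x, f x ≤ 2 := by
    intro x
    have h1 := abs_le.1 (hb x)
    have h2 := abs_le.1 (hb (refl1 i x))
    simp only [hf]; linarith
  set v : V d → ℝ := fun x => barr i M x - f x with hv
  set D : Finset (V d) := Finset.Icc (fun j => if j = i then 1 else -(m:ℤ)) (fun _ => (m:ℤ)) with hD
  have hmemD : ∀ x, x ∈ D ↔ 1 ≤ x i ∧ ∀ j, |x j| ≤ m := by
    intro x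
    rw [hD, Finset.mem_Icc, Pi.le_def, Pi.le_def]
    constructor
    · rintro ⟨h1, h2⟩
      have h1i := h1 i
      simp only [if_true] at h1i
      refine ⟨h1i, fun j => ?_⟩
      have h1j := h1 j
      have h2j := h2 j
      rw [abs_le]
      split_ifs at h1j with hj
      · exact ⟨by omega, h2j⟩
      · exact ⟨h1j, h2j⟩
    · rintro ⟨h1, h2⟩
      refine ⟨fun j => ?_, fun j => (abs_le.1 (h2 j)).2⟩
      split_ifs with hj
      · rw [hj]; exact h1
      · exact (abs_le.1 (h2 j)).1
  have hevD : ev i ∈ D := by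
    rw [hmemD]
    refine ⟨by rw [ev_same], fun j => ?_⟩
    by_cases hj : j = i
    · subst hj; rw [ev_same]; simp; exact_mod_cast hm
    · rw [ev_ne hj]; simp
  have hbarr0 : ∀ y : V d, 0 ≤ y i → (y i : ℝ) ≤ M → 0 ≤ barr i M y := by
    intro y h0 h1
    have h0' : (0:ℝ) ≤ y i := by exact_mod_cast h0
    unfold barr
    have := sqn_nonneg y
    have h3 : 0 ≤ (y i : ℝ) * (M - y i) := mul_nonneg h0' (by linarith)
    positivity
  have hbarr2 : ∀ y : V d, 0 ≤ y i → (y i : ℝ) ≤ M → M ^ 2 ≤ sqn y → 2 ≤ barr i M y := by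
    intro y h0 h1 h2
    have h0' : (0:ℝ) ≤ y i := by exact_mod_cast h0
    unfold barr
    have h3 : 0 ≤ (d + 1) * ((y i : ℝ) * (M - y i)) :=
      mul_nonneg (by positivity) (mul_nonneg h0' (by linarith))
    rw [le_div_iff₀ (by positivity)]
    linarith
  obtain ⟨x, hxD, hxmin⟩ := Finset.exists_min_image D v ⟨_, hevD⟩
  have hx := (hmemD x).1 hxD
  have hvx : 0 ≤ v x := by
    by_contra hneg
    push Not at hneg
    have hxi : (x i : ℝ) ≤ M := by
      have := (abs_le.1 (hx.2 i)).2
      have : (x i : ℝ) ≤ m := by exact_mod_cast this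
      linarith
    -- neighbours
    have hnb : ∀ y : V d, (∀ j, |y j| ≤ m + 1) → (1 ≤ y i) → v x ≤ v y := by
      intro y hy1 hy2
      by_cases hyD : y ∈ D
      · exact hxmin y hyD
      · have : ∃ j, |y j| = m + 1 := by
          by_contra hcon
          push Not at hcon
          apply hyD
          rw [hmemD]
          refine ⟨hy2, fun j => ?_⟩
          have := hy1 j
          have := hcon j
          omega
        obtain ⟨j, hj⟩ := this
        have hyi : (y i : ℝ) ≤ M := by
          have := (abs_le.1 (hy1 i)).2
          rw [hM]; exact_mod_cast this
        have hsq : M ^ 2 ≤ sqn y := by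
          refine le_trans (le_of_eq ?_) (coord_sq_le y j)
          rw [← sq_abs (y j : ℝ), hM]
          congr 1
          exact_mod_cast hj.symm
        have := hbarr2 y (by omega) hyi hsq
        have := hf2 y
        simp only [hv] at hneg ⊢
        linarith
    have hplus : ∀ j, v x ≤ v (x + ev j) := by
      intro j
      apply hnb
      · intro k
        have := abs_le.1 (hx.2 k)
        by_cases hk : k = j
        · subst hk; simp only [Pi.add_apply, ev_same]; rw [abs_le]; constructor <;> omega
        · simp only [Pi.add_apply, ev_ne hk]; rw [abs_le]; constructor <;> omega
      · by_cases hk : i = j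
        · subst hk; simp only [Pi.add_apply, ev_same]; omega
        · simp only [Pi.add_apply, ev_ne hk]; omega
    have hminus : ∀ j, v x ≤ v (x - ev j) := by
      intro j
      by_cases hcase : j = i ∧ x i = 1
      · obtain ⟨rfl, hxi1⟩ := hcase
        have hr : refl1 j x = x - ev j := by
          ext k; by_cases hk : k = j
          · subst hk; simp [refl1_same, ev_same, hxi1]
          · simp [refl1_ne hk, ev_ne hk]
        have hr' : refl1 j (x - ev j) = x := by rw [← hr, refl1_refl1]
        have hfy : f (x - ev j) = - f x := by
          simp only [hf]; rw [hr', hr]; ring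
        have b1 := hbarr0 x (by omega) hxi
        have b2 := hbarr0 (x - ev j) (by simp [ev_same, hxi1]) (by simp [ev_same, hxi1]; positivity)
        simp only [hv] at hneg ⊢
        rw [hfy]
        linarith
      · apply hnb
        · intro k
          have := abs_le.1 (hx.2 k)
          by_cases hk : k = j
          · subst hk; simp only [Pi.sub_apply, ev_same]; rw [abs_le]; constructor <;> omega
          · simp only [Pi.sub_apply, ev_ne hk]; rw [abs_le]; constructor <;> omega
        · have h1 := hx.1
          by_cases hk : i = j
          · subst hk
            have : x i ≠ 1 := fun h => hcase ⟨rfl, h⟩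
            simp only [Pi.sub_apply, ev_same]; omega
          · simp only [Pi.sub_apply, ev_ne hk]; omega
    have hLv : 0 ≤ Lap v x := Finset.sum_nonneg fun j _ => by
      have := hplus j
      have := hminus j
      linarith
    have hLeq : Lap v x = Lap (barr i M) x - (Lap h x - Lap h (refl1 i x)) := by
      rw [← Lap_refl1]
      unfold Lap
      simp only [← Finset.sum_sub_distrib, hv, hf]
      refine Finset.sum_congr rfl fun j _ => ?_
      ring
    rw [hLeq, Lap_barr i hMpos, hh x hx.2, hh (refl1 i x) ?_] at hLv
    · have : 0 < 4 / M ^ 2 := by positivity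
      have h4 : -4 / M ^ 2 = - (4 / M ^ 2) := by ring
      rw [h4] at hLv
      linarith
    · intro j
      by_cases hj : j = i
      · subst hj
        have := abs_le.1 (hx.2 j)
        have := hx.1
        rw [refl1_same, abs_le]; constructor <;> omega
      · rw [refl1_ne hj]; exact hx.2 j
  have hve : 0 ≤ v (ev i) := hvx.trans (hxmin _ hevD)
  have hr0 : refl1 i (ev i) = 0 := by
    ext k; by_cases hk : k = i
    · subst hk; simp [refl1_same, ev_same]
    · simp [refl1_ne hk, ev_ne hk]
  have hs : sqn (ev i) = 1 := by
    have := sqn_add_one (0 : V d) i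
    simp [sqn] at this
    simpa [sqn] using this
  simp only [hv, hf, hr0, barr, hs, ev_same] at hve
  refine le_trans (by linarith : h (ev i) - h 0 ≤ _) ?_ (b := 2 * (1 + (d + 1) * ((1:ℤ) * (M - (1:ℤ)))) / M ^ 2)
  rw [div_le_div_iff₀ (by positivity) hMpos]
  push_cast
  have : (0:ℝ) ≤ d := by positivity
  nlinarith [mul_nonneg this hMpos.le]

lemma Lap_translate {d : ℕ} (h : V d → ℝ) (z x : V d) :
    Lap (fun x => h (z + x)) x = Lap h (z + x) := by
  unfold Lap
  refine Finset.sum_congr rfl fun j _ => ?_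
  beta_reduce
  rw [← add_assoc, ← add_sub_assoc z x (ev j)]

lemma Lap_neg {d : ℕ} (h : V d → ℝ) (x : V d) :
    Lap (fun x => - h x) x = - Lap h x := by
  unfold Lap
  rw [← Finset.sum_neg_distrib]
  refine Finset.sum_congr rfl fun j _ => ?_
  ring

lemma grad_est {d : ℕ} (h : V d → ℝ) (hb : ∀ x, |h x| ≤ 1) (m : ℕ) (i : Fin d) (z : V d)
    (hh : ∀ x : V d, (∀ j, |x j - z j| ≤ m) → Lap h x = 0) :
    |h (z + ev i) - h z| ≤ 2 * (d + 1) / (m + 1) := by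
  rcases Nat.eq_zero_or_pos m with hm | hm
  · subst hm
    have h1 := abs_le.1 (hb z)
    have h2 := abs_le.1 (hb (z + ev i))
    have : (0:ℝ) ≤ d := by positivity
    rw [abs_le]; norm_num; constructor <;> linarith
  · have hh' : ∀ x : V d, (∀ j, |x j| ≤ m) → Lap h (z + x) = 0 := by
      intro x hx
      apply hh
      intro j
      simpa using hx j
    have h1 := grad_aux (fun x => h (z + x)) (fun x => hb _) m hm i
      (fun x hx => by rw [Lap_translate]; exact hh' x hx)
    have h2 := grad_aux (fun x => - h (z + x)) (fun x => by rw [abs_neg]; exact hb _) m hm i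
      (fun x hx => by rw [Lap_neg, Lap_translate, hh' x hx, neg_zero])
    simp only [add_zero] at h1 h2
    rw [abs_le]; constructor <;> linarith


open MeasureTheory Filter
open scoped ENNReal

lemma lip_cube {d : ℕ} (h : V d → ℝ) (hb : ∀ x, |h x| ≤ 1) (m : ℕ)
    (hh : ∀ x : V d, (∀ j, |x j| ≤ 2 * m) → Lap h x = 0) (N : ℕ) :
    ∀ x : V d, ∑ j, (x j).natAbs = N → (∀ j, |x j| ≤ m) →
      |h x - h 0| ≤ 2 * (d + 1) / (m + 1) * N := by
  have hgrad : ∀ z : V d, (∀ j, |z j| ≤ m) → ∀ i, |h (z + ev i) - h z| ≤ 2 * (d + 1) / (m + 1) := by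
    intro z hz i
    apply grad_est h hb
    intro x hx
    apply hh
    intro j
    have h1 := abs_le.1 (hz j)
    have h2 := abs_le.1 (hx j)
    rw [abs_le]; constructor <;> omega
  induction N with
  | zero =>
    intro x hx _
    have : x = 0 := by
      ext j
      have := (Finset.sum_eq_zero_iff.1 hx) j (Finset.mem_univ j)
      simpa using this
    subst this; simp
  | succ N ih =>
    intro x hx hc
    have hex : ∃ i, x i ≠ 0 := by
      by_contra hcon
      push Not at hcon
      simp [hcon] at hx
    obtain ⟨i, hi⟩ := hex
    have key : ∀ y : V d, (∀ j, j ≠ i → y j = x j) → (y i).natAbs + 1 = (x i).natAbs →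
        |h x - h y| ≤ 2 * (d + 1) / (m + 1) → |h x - h 0| ≤ 2 * (d + 1) / (m + 1) * ((N + 1 : ℕ):ℝ) := by
      intro y hy1 hy2 hy3
      have hsum : ∑ j, (y j).natAbs = N := by
        rw [← Finset.add_sum_erase _ _ (Finset.mem_univ i)] at hx ⊢
        have : ∑ j ∈ Finset.univ.erase i, (y j).natAbs = ∑ j ∈ Finset.univ.erase i, (x j).natAbs :=
          Finset.sum_congr rfl fun j hj => by rw [hy1 j (Finset.ne_of_mem_erase hj)]
        omega
      have h1 := ih y hsum (fun j => by
        by_cases hj : j = i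
        · subst hj; have := hc j; rw [Int.abs_eq_natAbs] at this ⊢; omega
        · rw [hy1 j hj]; exact hc j)
      have h2 := abs_sub_le (h x) (h y) (h 0)
      push_cast
      linarith
    rcases lt_or_gt_of_ne hi with hneg | hpos
    · apply key (x + ev i)
      · intro j hj; simp [ev_ne hj]
      · simp only [Pi.add_apply, ev_same]; omega
      · rw [abs_sub_comm]; exact hgrad x hc i
    · have hg := hgrad (x - ev i) (fun j => by
        by_cases hj : j = i
        · subst hj; have := hc j; simp only [Pi.sub_apply, ev_same]; rw [abs_le] at this ⊢; omega
        · simp only [Pi.sub_apply, ev_ne hj]; simpa using hc j) i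
      rw [sub_add_cancel] at hg
      apply key (x - ev i)
      · intro j hj; simp [ev_ne hj]
      · simp only [Pi.sub_apply, ev_same]; omega
      · exact hg

lemma abs_coord_le {d : ℕ} (x : V d) (j : Fin d) : |(x j : ℝ)| ≤ Real.sqrt (sqn x) :=
  Real.abs_le_sqrt (coord_sq_le x j)

lemma lip {d : ℕ} (hd : 1 ≤ d) (h : V d → ℝ) (hb : ∀ x, |h x| ≤ 1) (n : ℕ) (hn : 1 ≤ n)
    (hh : ∀ x ∈ ball d n, Lap h x = 0) (x : V d) :
    |h x - h 0| ≤ 4 * d ^ 2 * (d + 1) / n * Real.sqrt (sqn x) := by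
  have hd' : (1:ℝ) ≤ d := by exact_mod_cast hd
  have hn' : (1:ℝ) ≤ n := by exact_mod_cast hn
  set m := n / (2 * d) with hm
  have hm1 : 2 * d * m ≤ n := Nat.mul_div_le n (2 * d)
  have hm2 : n < 2 * d * (m + 1) := by
    have := Nat.lt_mul_div_succ n (b := 2 * d) (by omega)
    simpa [hm] using this
  have hm1' : 2 * (d:ℝ) * m ≤ n := by exact_mod_cast hm1
  have hm2' : (n:ℝ) < 2 * d * (m + 1) := by exact_mod_cast hm2
  by_cases hc : ∀ j, |x j| ≤ m
  · have hcube : ∀ x : V d, (∀ j, |x j| ≤ 2 * m) → Lap h x = 0 := by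
      intro x hx
      apply hh
      rw [mem_ball_iff]
      have h1 : sqn x ≤ ∑ j : Fin d, (2 * (m:ℝ)) ^ 2 := by
        refine Finset.sum_le_sum fun j _ => ?_
        have := hx j
        have : |(x j : ℝ)| ≤ 2 * m := by exact_mod_cast this
        exact sq_le_sq' (abs_le.1 this).1 (abs_le.1 this).2
      simp at h1
      have h2 : (2 * d * (m:ℝ)) ^ 2 ≤ n ^ 2 := by gcongr
      have h3 : (d:ℝ) * (2 * m) ^ 2 ≤ (2 * d * (m:ℝ)) ^ 2 := by
        have : (2 * d * (m:ℝ)) ^ 2 = d * (d * (2 * m) ^ 2) := by ring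
        rw [this]
        have : 0 ≤ (d:ℝ) * (2 * m) ^ 2 := by positivity
        nlinarith
      linarith
    have h1 := lip_cube h hb m hcube _ x rfl hc
    have h2 : ((∑ j, (x j).natAbs : ℕ) : ℝ) ≤ d * Real.sqrt (sqn x) := by
      push_cast
      calc ∑ j, ((x j).natAbs : ℝ) ≤ ∑ j : Fin d, Real.sqrt (sqn x) := by
            refine Finset.sum_le_sum fun j _ => ?_
            rw [Nat.cast_natAbs]; push_cast; exact abs_coord_le x j
        _ = _ := by simp
    refine h1.trans ?_
    have h3 : 2 * ((d:ℝ) + 1) / (m + 1) ≤ 4 * d * (d + 1) / n := by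
      rw [div_le_div_iff₀ (by positivity) (by positivity)]
      nlinarith
    calc _ ≤ 4 * (d:ℝ) * (d + 1) / n * (d * Real.sqrt (sqn x)) := by gcongr
      _ = _ := by ring
  · push Not at hc
    obtain ⟨j, hj⟩ := hc
    have hj' : (m:ℝ) + 1 ≤ |(x j : ℝ)| := by exact_mod_cast hj
    have h1 := abs_coord_le x j
    have h2 : |h x - h 0| ≤ 2 := by
      have := abs_le.1 (hb x); have := abs_le.1 (hb 0)
      rw [abs_le]; constructor <;> linarith
    refine h2.trans ?_
    have h3 : (n:ℝ) ≤ 2 * d * Real.sqrt (sqn x) := by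
      have : 2 * (d:ℝ) * (m + 1) ≤ 2 * d * Real.sqrt (sqn x) := by
        gcongr; linarith
      linarith
    rw [div_mul_eq_mul_div, le_div_iff₀ (by positivity)]
    have : 4 * (d:ℝ) ^ 2 * (d + 1) * Real.sqrt (sqn x) = 2 * (d * (d + 1)) * (2 * d * Real.sqrt (sqn x)) := by ring
    rw [this]
    have : (1:ℝ) ≤ d * (d + 1) := by nlinarith
    nlinarith

/-- sum over the lattice of shifts -/
lemma tsum_shift {d : ℕ} (f : V d → ℝ) (z : V d) : ∑' x, f (x + z) = ∑' x, f x :=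
  (Equiv.addRight z).tsum_eq f

lemma fs_shift {d : ℕ} {f : V d → ℝ} (hf : (Function.support f).Finite) (z : V d) :
    (Function.support fun x => f (x + z)).Finite :=
  hf.preimage (f := fun x => x + z) (add_left_injective z).injOn

/-- summation by parts with step `k` -/
lemma sbp {d : ℕ} (k : ℤ) (u h : V d → ℝ) (hu : (Function.support u).Finite) :
    ∑' x, h x * ∑ i, (u (x + k • ev i) + u (x - k • ev i) - 2 * u x) =
    ∑' x, u x * ∑ i, (h (x + k • ev i) + h (x - k • ev i) - 2 * h x) := by
  have hS : ∀ (g : V d → ℝ) (z : V d), Summable fun x => g x * u (x + z) := fun g z =>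
    summable_of_hasFiniteSupport ((fs_shift hu z).subset (Function.support_mul_subset_right _ _))
  have hS' : ∀ (g : V d → ℝ), Summable fun x => g x * u x := fun g => by simpa using hS g 0
  have hT : ∀ z : V d, ∑' x, h x * u (x + z) = ∑' x, h (x - z) * u x := by
    intro z
    rw [← tsum_shift (fun x => h (x - z) * u x) z]
    simp
  have e1 : ∀ x, h x * ∑ i, (u (x + k • ev i) + u (x - k • ev i) - 2 * u x) =
      ∑ i, (h x * u (x + k • ev i) + h x * u (x + -(k • ev i)) - 2 * h x * u x) := by
    intro x; rw [Finset.mul_sum]; refine Finset.sum_congr rfl fun i _ => ?_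
    rw [← sub_eq_add_neg]; ring
  have e2 : ∀ x, u x * ∑ i, (h (x + k • ev i) + h (x - k • ev i) - 2 * h x) =
      ∑ i, (h (x + k • ev i) * u x + h (x - k • ev i) * u x - 2 * h x * u x) := by
    intro x; rw [Finset.mul_sum]; refine Finset.sum_congr rfl fun i _ => ?_
    ring
  simp_rw [e1, e2]
  rw [Summable.tsum_finsetSum (fun i _ => ((hS _ _).add (hS _ _)).sub (hS' fun x => 2 * h x)),
    Summable.tsum_finsetSum (fun i _ => ((hS' fun x => h (x + k • ev i)).add
      (hS' fun x => h (x - k • ev i))).sub (hS' fun x => 2 * h x))]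
  refine Finset.sum_congr rfl fun i _ => ?_
  rw [Summable.tsum_sub ((hS _ _).add (hS _ _)) (hS' fun x => 2 * h x),
    Summable.tsum_add (hS _ _) (hS _ _),
    Summable.tsum_sub ((hS' fun x => h (x + k • ev i)).add (hS' fun x => h (x - k • ev i)))
      (hS' fun x => 2 * h x),
    Summable.tsum_add (hS' fun x => h (x + k • ev i)) (hS' fun x => h (x - k • ev i)), hT, hT]
  simp only [sub_neg_eq_add]
  ring


open MeasureTheory Filter
open scoped ENNReal

lemma mvt_step {g g' : ℝ → ℝ} {a b B : ℝ} (hab : a ≤ b)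
    (hd : ∀ r ∈ Set.Icc a b, HasDerivAt g (g' r) r) (hB : ∀ r ∈ Set.Icc a b, |g' r| ≤ B) :
    |g b - g a| ≤ B * (b - a) := by
  have := (convex_Icc a b).norm_image_sub_le_of_norm_hasDerivWithin_le (f := g) (f' := g') (C := B)
    (fun r hr => (hd r hr).hasDerivWithinAt) (fun r hr => by rw [Real.norm_eq_abs]; exact hB r hr)
    (Set.left_mem_Icc.2 hab) (Set.right_mem_Icc.2 hab)
  rw [Real.norm_eq_abs, Real.norm_eq_abs, abs_of_nonneg (sub_nonneg.2 hab)] at this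
  exact this

lemma mvt_zero {g g' : ℝ → ℝ} {t B : ℝ} (hB0 : 0 ≤ B) (h0 : g 0 = 0)
    (hd : ∀ r ∈ Set.Icc 0 t, HasDerivAt g (g' r) r) (hB : ∀ r ∈ Set.Icc 0 t, |g' r| ≤ B) :
    ∀ r ∈ Set.Icc 0 t, |g r| ≤ B * t := by
  intro r hr
  have := mvt_step (g := g) (g' := g') (B := B) hr.1 (fun s hs => hd s ⟨hs.1, hs.2.trans hr.2⟩)
    (fun s hs => hB s ⟨hs.1, hs.2.trans hr.2⟩)
  rw [h0, sub_zero, sub_zero] at this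
  exact this.trans (mul_le_mul_of_nonneg_left hr.2 hB0)

lemma taylor4 {f f1 f2 f3 f4 : ℝ → ℝ} {a t M : ℝ} (ht : 0 ≤ t) (hM : 0 ≤ M)
    (h1 : ∀ r ∈ Set.Icc (a - t) (a + t), HasDerivAt f (f1 r) r)
    (h2 : ∀ r ∈ Set.Icc (a - t) (a + t), HasDerivAt f1 (f2 r) r)
    (h3 : ∀ r ∈ Set.Icc (a - t) (a + t), HasDerivAt f2 (f3 r) r)
    (h4 : ∀ r ∈ Set.Icc (a - t) (a + t), HasDerivAt f3 (f4 r) r)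
    (hB : ∀ r ∈ Set.Icc (a - t) (a + t), |f4 r| ≤ M) :
    |f (a + t) + f (a - t) - 2 * f a - t ^ 2 * f2 a| ≤ 2 * M * t ^ 4 := by
  have mp : ∀ r ∈ Set.Icc 0 t, a + r ∈ Set.Icc (a - t) (a + t) := fun r hr =>
    ⟨by linarith [hr.1], by linarith [hr.2]⟩
  have mm : ∀ r ∈ Set.Icc 0 t, a - r ∈ Set.Icc (a - t) (a + t) := fun r hr =>
    ⟨by linarith [hr.2], by linarith [hr.1]⟩
  have dp : ∀ {g g' : ℝ → ℝ}, (∀ r ∈ Set.Icc (a - t) (a + t), HasDerivAt g (g' r) r) →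
      ∀ r ∈ Set.Icc 0 t, HasDerivAt (fun r => g (a + r)) (g' (a + r)) r := by
    intro g g' hg r hr
    exact HasDerivAt.comp_const_add a r (hg _ (mp r hr))
  have dm : ∀ {g g' : ℝ → ℝ}, (∀ r ∈ Set.Icc (a - t) (a + t), HasDerivAt g (g' r) r) →
      ∀ r ∈ Set.Icc 0 t, HasDerivAt (fun r => g (a - r)) (-(g' (a - r))) r := by
    intro g g' hg r hr
    exact HasDerivAt.comp_const_sub a r (hg _ (mm r hr))
  have s3 : ∀ r ∈ Set.Icc 0 t, |f3 (a + r) - f3 (a - r)| ≤ (2 * M) * t :=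
    mvt_zero (g := fun r => f3 (a + r) - f3 (a - r)) (g' := fun r => f4 (a + r) - -(f4 (a - r)))
      (by positivity) (by simp) (fun r hr => (dp h4 r hr).sub (dm h4 r hr))
      (fun r hr => by
        have e1 := abs_le.1 (hB _ (mp r hr)); have e2 := abs_le.1 (hB _ (mm r hr))
        rw [abs_le]; constructor <;> linarith)
  have s2 : ∀ r ∈ Set.Icc 0 t, |f2 (a + r) + f2 (a - r) - 2 * f2 a| ≤ (2 * M) * t * t :=
    mvt_zero (g := fun r => f2 (a + r) + f2 (a - r) - 2 * f2 a)
      (g' := fun r => f3 (a + r) + -(f3 (a - r)))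
      (by positivity) (by simp; ring) (fun r hr => ((dp h3 r hr).add (dm h3 r hr)).sub_const _)
      (fun r hr => by rw [← sub_eq_add_neg]; exact s3 r hr)
  have s1 : ∀ r ∈ Set.Icc 0 t, |f1 (a + r) - f1 (a - r) - r * (2 * f2 a)| ≤ (2 * M) * t * t * t :=
    mvt_zero (g := fun r => f1 (a + r) - f1 (a - r) - r * (2 * f2 a))
      (g' := fun r => f2 (a + r) - -(f2 (a - r)) - 1 * (2 * f2 a))
      (by positivity) (by simp)
      (fun r hr => ((dp h2 r hr).sub (dm h2 r hr)).sub ((hasDerivAt_id r).mul_const _))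
      (fun r hr => by
        rw [sub_neg_eq_add, one_mul]; exact s2 r hr)
  have s0 := mvt_zero (g := fun r => f (a + r) + f (a - r) - 2 * f a - r ^ 2 * f2 a)
      (g' := fun r => f1 (a + r) + -(f1 (a - r)) - (2 * r) * f2 a) (t := t)
      (B := (2 * M) * t * t * t)
      (by positivity) (by simp; ring)
      (fun r hr => (((dp h1 r hr).add (dm h1 r hr)).sub_const _).sub
        (by simpa using (hasDerivAt_pow 2 r).mul_const (f2 a)))
      (fun r hr => by
        have := s1 r hr
        rw [show f1 (a + r) + -(f1 (a - r)) - (2 * r) * f2 a =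
          f1 (a + r) - f1 (a - r) - r * (2 * f2 a) by ring]; exact this)
  refine (s0 t ⟨ht, le_rfl⟩).trans (le_of_eq ?_)
  ring

/-- a primitive of `- w ^ (-α)` -/
lemma exists_Q (α : ℝ) : ∃ Q : ℝ → ℝ, ∀ w, 0 < w → HasDerivAt Q (-(w ^ (-α))) w := by
  by_cases h : α = 1
  · subst h
    refine ⟨fun w => - Real.log w, fun w hw => ?_⟩
    rw [Real.rpow_neg_one]
    exact (Real.hasDerivAt_log hw.ne').neg
  · refine ⟨fun w => w ^ (1 - α) * (-(1 / (1 - α))), fun w hw => ?_⟩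
    have := ((Real.hasDerivAt_rpow_const (x := w) (p := 1 - α) (Or.inl hw.ne')).mul_const
      (-(1 / (1 - α))))
    refine this.congr_deriv ?_
    have : (1 - α) ≠ 0 := sub_ne_zero.2 (Ne.symm h)
    rw [show 1 - α - 1 = -α by ring]
    field_simp

lemma rpow_deriv {p w : ℝ} (c : ℝ) (hw : 0 < w) :
    HasDerivAt (fun w : ℝ => c * w ^ p) (c * p * w ^ (p - 1)) w := by
  have := (Real.hasDerivAt_rpow_const (x := w) (p := p) (Or.inl hw.ne')).const_mul c
  refine this.congr_deriv ?_
  ring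

lemma rpow_anti {a b p : ℝ} (ha : 0 < a) (hab : a ≤ b) (hp : p ≤ 0) : b ^ p ≤ a ^ p :=
  Real.rpow_le_rpow_of_nonpos ha hab hp

/-- difference of negative powers -/
lemma rpow_diff {a b α : ℝ} (hα : 0 ≤ α) (ha : 0 < a) (hab : a ≤ b) :
    |b ^ (-α) - a ^ (-α)| ≤ α * a ^ (-α - 1) * (b - a) := by
  have := mvt_step (g := fun w : ℝ => 1 * w ^ (-α)) (g' := fun w => 1 * (-α) * w ^ (-α - 1))
    (B := α * a ^ (-α - 1)) hab
    (fun r hr => rpow_deriv 1 (ha.trans_le hr.1)) (fun r hr => by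
      have hr0 : 0 < r := ha.trans_le hr.1
      rw [abs_mul, one_mul, abs_neg, abs_of_nonneg hα, abs_of_nonneg (Real.rpow_nonneg hr0.le _)]
      exact mul_le_mul_of_nonneg_left (rpow_anti ha hr.1 (by linarith)) hα)
  simpa using this

section
variable {Q : ℝ → ℝ} {α : ℝ}

lemma Q_second (hα : 0 ≤ α) (hQ : ∀ w, 0 < w → HasDerivAt Q (-(w ^ (-α))) w)
    {q y : ℝ} (hq : 2 ≤ q) (hy : y ^ 2 ≤ q - 2) :
    |Q (q + 1 + 2 * y) + Q (q + 1 - 2 * y) - 2 * Q (q + 1) - 4 * y ^ 2 * (α * (q + 1) ^ (-α - 1))|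
      ≤ 32 * (α * (α + 1) * (α + 2)) * (2:ℝ) ^ (α + 3) * q ^ (-α - 1) := by
  wlog hy0 : 0 ≤ y generalizing y
  · have := this (y := -y) (by simpa using hy) (by linarith)
    rw [show q + 1 + 2 * -y = q + 1 - 2 * y by ring, show q + 1 - 2 * -y = q + 1 + 2 * y by ring,
      neg_sq, add_comm (Q _) (Q _)] at this
    exact this
  have hlow : q / 2 ≤ q + 1 - 2 * y := by nlinarith [sq_nonneg (y - 2)]
  have hpos : ∀ r ∈ Set.Icc (q + 1 - 2 * y) (q + 1 + 2 * y), 0 < r := fun r hr => by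
    have := hr.1; linarith
  have hq2 : 0 < q / 2 := by linarith
  have key := taylor4 (f := Q) (f1 := fun w => -1 * w ^ (-α)) (f2 := fun w => -1 * (-α) * w ^ (-α - 1))
    (f3 := fun w => -1 * (-α) * (-α - 1) * w ^ (-α - 1 - 1))
    (f4 := fun w => -1 * (-α) * (-α - 1) * (-α - 1 - 1) * w ^ (-α - 1 - 1 - 1))
    (a := q + 1) (t := 2 * y) (M := α * (α + 1) * (α + 2) * (q / 2) ^ (-α - 1 - 1 - 1))
    (by positivity) (by positivity)
    (fun r hr => by simpa using hQ r (hpos r hr))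
    (fun r hr => rpow_deriv _ (hpos r hr))
    (fun r hr => rpow_deriv _ (hpos r hr))
    (fun r hr => rpow_deriv _ (hpos r hr))
    (fun r hr => by
      rw [abs_mul, abs_of_nonneg (Real.rpow_nonneg (hpos r hr).le _),
        show -1 * (-α) * (-α - 1) * (-α - 1 - 1) = α * (α + 1) * (α + 2) by ring,
        abs_of_nonneg (by positivity)]
      exact mul_le_mul_of_nonneg_left (rpow_anti hq2 (hlow.trans hr.1) (by linarith)) (by positivity))
  rw [show (2 * y) ^ 2 * (-1 * (-α) * (q + 1) ^ (-α - 1)) = 4 * y ^ 2 * (α * (q + 1) ^ (-α - 1)) by ring]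
    at key
  refine key.trans ?_
  have e1 : (q / 2) ^ (-α - 1 - 1 - 1) = (2:ℝ) ^ (α + 3) * (q ^ (-α - 1) / q ^ 2) := by
    rw [Real.div_rpow (by linarith) (by norm_num), div_eq_mul_inv, ← Real.rpow_neg (by norm_num),
      show -α - 1 - 1 - 1 = (-α - 1) - 2 by ring, Real.rpow_sub (by linarith) (-α - 1) 2,
      Real.rpow_two, mul_comm]
    congr 2
    ring
  rw [e1]
  have e2 : (2 * y) ^ 4 ≤ 16 * q ^ 2 := by
    have : y ^ 2 * y ^ 2 ≤ q * q := by
      apply mul_le_mul <;> nlinarith [sq_nonneg y]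
    nlinarith
  have hq0 : 0 < q := by linarith
  calc _ ≤ 2 * (α * (α + 1) * (α + 2) * ((2:ℝ) ^ (α + 3) * (q ^ (-α - 1) / q ^ 2))) * (16 * q ^ 2) := by
        gcongr
    _ = _ := by field_simp; ring

lemma Q_first (hα : 0 ≤ α) (hQ : ∀ w, 0 < w → HasDerivAt Q (-(w ^ (-α))) w)
    {q : ℝ} (hq : 2 ≤ q) :
    |Q (q + 1) - Q q + (q + 1) ^ (-α)| ≤ α * q ^ (-α - 1) := by
  have hq0 : 0 < q := by linarith
  have := mvt_step (g := fun r => Q r + r * (q + 1) ^ (-α)) (g' := fun r => -(r ^ (-α)) + 1 * (q + 1) ^ (-α))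
    (a := q) (b := q + 1) (B := α * q ^ (-α - 1)) (by linarith)
    (fun r hr => (hQ r (hq0.trans_le hr.1)).add ((hasDerivAt_id r).mul_const _))
    (fun r hr => by
      have hr0 := hq0.trans_le hr.1
      have h1 := rpow_diff hα hr0 hr.2
      rw [show -(r ^ (-α)) + 1 * (q + 1) ^ (-α) = (q + 1) ^ (-α) - r ^ (-α) by ring]
      refine h1.trans ?_
      have h2 : r ^ (-α - 1) ≤ q ^ (-α - 1) := rpow_anti hq0 hr.1 (by linarith)
      have h3 : α * r ^ (-α - 1) ≤ α * q ^ (-α - 1) := mul_le_mul_of_nonneg_left h2 hα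
      have h4 : 0 ≤ α * r ^ (-α - 1) := by positivity
      nlinarith [hr.1])
  rw [show q + 1 - q = 1 by ring, mul_one] at this
  convert this using 2
  ring

/-- interior estimate constant -/
noncomputable def Cin (d : ℕ) : ℝ :=
  d * (32 * ((d:ℝ) / 2 * ((d:ℝ) / 2 + 1) * ((d:ℝ) / 2 + 2)) * (2:ℝ) ^ ((d:ℝ) / 2 + 3)) +
    2 * d * ((d:ℝ) / 2) + 6 * d

lemma Q_interior {d : ℕ} (hα : α = (d:ℝ) / 2)
    (hQ : ∀ w, 0 < w → HasDerivAt Q (-(w ^ (-α))) w) (x : V d) :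
    |∑ i, (Q (sqn x + 2 + 1 + 2 * x i) + Q (sqn x + 2 + 1 - 2 * x i) - 2 * Q (sqn x + 2))|
      ≤ Cin d * (sqn x + 2) ^ (-α - 1) := by
  have hα0 : 0 ≤ α := by rw [hα]; positivity
  have hs := sqn_nonneg x
  set q := sqn x + 2 with hq
  have hq2 : 2 ≤ q := by linarith
  set W := 32 * (α * (α + 1) * (α + 2)) * (2:ℝ) ^ (α + 3) with hW
  set E : Fin d → ℝ := fun i => Q (q + 1 + 2 * x i) + Q (q + 1 - 2 * x i) - 2 * Q (q + 1)
    - 4 * (x i:ℝ) ^ 2 * (α * (q + 1) ^ (-α - 1)) with hE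
  have h1 : ∀ i, |E i| ≤ W * q ^ (-α - 1) := fun i => by
    have := Q_second (y := (x i : ℝ)) hα0 hQ hq2 (by have := coord_sq_le x i; rw [hq]; linarith)
    exact this
  have h2 : |∑ i, E i| ≤ d * (W * q ^ (-α - 1)) := by
    refine (Finset.abs_sum_le_sum_abs _ _).trans ?_
    refine (Finset.sum_le_sum fun i _ => h1 i).trans ?_
    simp
  have h3 := Q_first hα0 hQ hq2
  have hp : (q + 1) ^ (-α) = (q + 1) * (q + 1) ^ (-α - 1) := by
    rw [Real.rpow_sub_one (by linarith)]
    have : q + 1 ≠ 0 := by linarith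
    field_simp
  have h5 : (q + 1) ^ (-α - 1) ≤ q ^ (-α - 1) := rpow_anti (by linarith) (by linarith) (by linarith)
  have h6 : 0 ≤ (q + 1) ^ (-α - 1) := Real.rpow_nonneg (by linarith) _
  have h4 : ∑ i, (Q (q + 1 + 2 * x i) + Q (q + 1 - 2 * x i) - 2 * Q q) =
      ∑ i, E i + 2 * d * (Q (q + 1) - Q q + (q + 1) ^ (-α)) - 6 * d * (q + 1) ^ (-α - 1) := by
    have e : ∀ i, (Q (q + 1 + 2 * x i) + Q (q + 1 - 2 * x i) - 2 * Q q) =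
        E i + 4 * (α * (q + 1) ^ (-α - 1)) * (x i:ℝ) ^ 2 + 2 * (Q (q + 1) - Q q) := by
      intro i; simp only [hE]; ring
    rw [Finset.sum_congr rfl fun i _ => e i, Finset.sum_add_distrib, Finset.sum_add_distrib,
      ← Finset.mul_sum]
    have : ∑ i, (x i:ℝ) ^ 2 = q - 2 := by rw [hq]; unfold sqn; ring
    rw [this, hp, hα]
    simp
    ring
  rw [h4]
  have h7 : |2 * d * (Q (q + 1) - Q q + (q + 1) ^ (-α))| ≤ 2 * d * (α * q ^ (-α - 1)) := by
    rw [abs_mul, abs_of_nonneg (by positivity)]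
    gcongr
  have h8 : |6 * d * (q + 1) ^ (-α - 1)| ≤ 6 * d * q ^ (-α - 1) := by
    rw [abs_of_nonneg (by positivity)]
    gcongr
  have : Cin d * q ^ (-α - 1) = d * (W * q ^ (-α - 1)) + 2 * d * (α * q ^ (-α - 1)) + 6 * d * q ^ (-α - 1) := by
    rw [hW, hα]; unfold Cin; ring
  rw [this]
  refine (abs_sub _ _).trans ?_
  refine (add_le_add (abs_add_le _ _) le_rfl).trans ?_
  linarith

/-- the radial profile -/
noncomputable def Fr (Q : ℝ → ℝ) (α : ℝ) (n : ℕ) (s : ℝ) : ℝ :=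
  ((n:ℝ) ^ 2 + 2) ^ (-α) * (s - (n:ℝ) ^ 2) + Q (s + 2) - Q ((n:ℝ) ^ 2 + 2)

lemma Fr_boundary (hα : 0 ≤ α) (hQ : ∀ w, 0 < w → HasDerivAt Q (-(w ^ (-α))) w) {n : ℕ} (hn : 4 ≤ n)
    {s : ℝ} (hs1 : ((n:ℝ) - 2) ^ 2 ≤ s) (hs2 : s ≤ (n:ℝ) ^ 2) :
    |Fr Q α n s| ≤ 16 * α * (4:ℝ) ^ (α + 1) * ((n:ℝ) ^ 2) ^ (-α) := by
  have hn' : (4:ℝ) ≤ n := by exact_mod_cast hn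
  have hlow : (n:ℝ) ^ 2 / 4 ≤ s := by nlinarith
  have hs0 : 0 ≤ s := by nlinarith
  have hp : 0 < (n:ℝ) ^ 2 / 4 := by positivity
  set B := α * ((n:ℝ) ^ 2 / 4) ^ (-α - 1) * (4 * n) with hB
  have := mvt_step (g := Fr Q α n) (g' := fun r => ((n:ℝ) ^ 2 + 2) ^ (-α) * 1 + -((r + 2) ^ (-α)))
    (B := B) hs2
    (fun r hr => by
      have hr0 : 0 < r + 2 := by linarith [hr.1]
      exact ((((hasDerivAt_id r).sub_const _).const_mul _).add
        (HasDerivAt.comp_add_const r 2 (hQ _ hr0))).sub_const _)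
    (fun r hr => by
      have hr0 : 0 < r + 2 := by linarith [hr.1]
      have h1 := rpow_diff (a := r + 2) (b := (n:ℝ) ^ 2 + 2) hα hr0 (by linarith [hr.2])
      rw [mul_one, ← sub_eq_add_neg]
      refine h1.trans ?_
      have h2 : (r + 2) ^ (-α - 1) ≤ ((n:ℝ) ^ 2 / 4) ^ (-α - 1) :=
        rpow_anti hp (by linarith [hr.1]) (by linarith)
      rw [hB]
      refine mul_le_mul (mul_le_mul_of_nonneg_left h2 hα) ?_ (by linarith [hr.2]) (by positivity)
      nlinarith [hr.1])
  have h0 : Fr Q α n ((n:ℝ) ^ 2) = 0 := by unfold Fr; ring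
  rw [h0, zero_sub, abs_neg] at this
  refine this.trans ?_
  have hB0 : 0 ≤ B := by positivity
  have h3 : (n:ℝ) ^ 2 - s ≤ 4 * n := by nlinarith
  refine (mul_le_mul_of_nonneg_left h3 hB0).trans (le_of_eq ?_)
  have e1 : ((n:ℝ) ^ 2 / 4) ^ (-α - 1) = (4:ℝ) ^ (α + 1) * (((n:ℝ) ^ 2) ^ (-α) / (n:ℝ) ^ 2) := by
    rw [Real.div_rpow (by positivity) (by norm_num), div_eq_mul_inv, ← Real.rpow_neg (by norm_num),
      Real.rpow_sub_one (by positivity) (-α), mul_comm]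
    congr 2
    ring
  rw [hB, e1]
  field_simp
  ring

end


open MeasureTheory Filter
open scoped ENNReal

lemma summable_1d {p : ℝ} (hp : 1 < 2 * p) : Summable fun k : ℤ => (1 + (k:ℝ) ^ 2) ^ (-p) := by
  have h1 := Real.summable_abs_int_rpow hp
  refine Summable.of_nonneg_of_le (fun k => by positivity) (fun k => ?_)
    (h1.add (summable_of_hasFiniteSupport (f := fun k : ℤ => if k = 0 then (1:ℝ) else 0)
      ((Set.finite_singleton (0:ℤ)).subset (fun k hk => by
        by_contra hne
        simp at hne
        simp [hne] at hk))))
  by_cases hk : k = 0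
  · subst hk
    simp only [if_true]
    have : (0:ℝ) ≤ |((0:ℤ):ℝ)| ^ (-(2 * p)) := by positivity
    simp at this ⊢
    exact this
  · simp only [if_neg hk, add_zero]
    have hk' : (0:ℝ) < |(k:ℝ)| := by positivity
    have : |(k:ℝ)| ^ (-(2 * p)) = ((k:ℝ) ^ 2) ^ (-p) := by
      rw [← sq_abs, ← Real.rpow_natCast, ← Real.rpow_mul hk'.le]
      congr 1
      push_cast; ring
    rw [this]
    exact rpow_anti (by positivity) (by linarith) (by linarith)

lemma sum_bound (d : ℕ) (hd : 1 ≤ d) : ∃ C : ℝ, 0 ≤ C ∧ ∀ T : Finset (V d),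
    ∑ x ∈ T, (sqn x + 2) ^ (-((d:ℝ) / 2) - 1 / 2) ≤ C := by
  have hd' : (1:ℝ) ≤ d := by exact_mod_cast hd
  set p : ℝ := ((d:ℝ) + 1) / (2 * d) with hp
  have hp1 : 1 < 2 * p := by
    rw [hp]; rw [← mul_div_assoc, lt_div_iff₀ (by positivity)]; linarith
  have hS := summable_1d hp1
  set S := ∑' k : ℤ, (1 + (k:ℝ) ^ 2) ^ (-p) with hSdef
  have hS0 : 0 ≤ S := tsum_nonneg fun k => by positivity
  refine ⟨S ^ d, by positivity, fun T => ?_⟩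
  have hpt : ∀ x : V d, (sqn x + 2) ^ (-((d:ℝ) / 2) - 1 / 2) ≤ ∏ i, (1 + (x i:ℝ) ^ 2) ^ (-p) := by
    intro x
    have hs := sqn_nonneg x
    have e : (sqn x + 2) ^ (-((d:ℝ) / 2) - 1 / 2) = ∏ i : Fin d, (sqn x + 2) ^ (-p) := by
      simp only [Finset.prod_const, Finset.card_univ, Fintype.card_fin]
      rw [← Real.rpow_natCast, ← Real.rpow_mul (by linarith)]
      congr 1
      rw [hp]; field_simp; ring
    rw [e]
    refine Finset.prod_le_prod (fun i _ => Real.rpow_nonneg (by linarith) _) fun i _ => ?_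
    have := coord_sq_le x i
    exact rpow_anti (by positivity) (by linarith) (by linarith)
  let t : Fin d → Finset ℤ := fun i => T.image (fun x => x i)
  calc ∑ x ∈ T, (sqn x + 2) ^ (-((d:ℝ) / 2) - 1 / 2)
      ≤ ∑ x ∈ T, ∏ i, (1 + (x i:ℝ) ^ 2) ^ (-p) := Finset.sum_le_sum fun x _ => hpt x
    _ ≤ ∑ x ∈ Fintype.piFinset t,
          ∏ i, (1 + (x i:ℝ) ^ 2) ^ (-p) := by
        refine Finset.sum_le_sum_of_subset_of_nonneg (fun x hx => ?_) (fun x _ _ => ?_)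
        swap
        · exact Finset.prod_nonneg fun i _ => by positivity
        rw [Fintype.mem_piFinset]
        exact fun i => Finset.mem_image_of_mem _ hx
    _ = ∏ i : Fin d, ∑ k ∈ t i, (1 + (k:ℝ) ^ 2) ^ (-p) := by
        rw [Finset.prod_univ_sum]
    _ ≤ ∏ i : Fin d, S := by
        refine Finset.prod_le_prod (fun i _ => Finset.sum_nonneg fun k _ => by positivity) fun i _ => ?_
        exact hS.sum_le_tsum _ (fun k _ => by positivity)
    _ = S ^ d := by simp

lemma card_cube (d m : ℕ) :
    (Finset.Icc (fun _ => -(m:ℤ) : V d) (fun _ => (m:ℤ))).card = (2 * m + 1) ^ d := by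
  rw [Pi.card_Icc]
  simp only [Int.card_Icc, Finset.prod_const, Finset.card_univ, Fintype.card_fin]
  congr 1
  omega

lemma bn_upper (d n : ℕ) : ((ball d n).card : ℝ) ≤ (2 * n + 1) ^ d := by
  have : (ball d n).card ≤ (2 * n + 1) ^ d := by
    rw [← card_cube]
    apply Finset.card_le_card
    intro x hx
    unfold ball at hx
    have := (Finset.mem_filter.1 hx).1
    simpa using this
  exact_mod_cast this

lemma bn_lower (d n : ℕ) (hd : 1 ≤ d) : ((n:ℝ) / d) ^ d ≤ bn d n := by
  have hd' : (1:ℝ) ≤ d := by exact_mod_cast hd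
  set m := n / d with hm
  have hm1 : d * m ≤ n := Nat.mul_div_le n d
  have hm2 : n < d * (m + 1) := by
    have := Nat.lt_mul_div_succ n (b := d) (by omega)
    simpa [hm] using this
  have hm1' : (d:ℝ) * m ≤ n := by exact_mod_cast hm1
  have hm2' : (n:ℝ) < d * (m + 1) := by exact_mod_cast hm2
  have h1 : (2 * m + 1) ^ d ≤ bn d n := by
    rw [← card_cube]
    apply Finset.card_le_card
    intro x hx
    rw [Finset.mem_Icc] at hx
    rw [mem_ball_iff]
    have h1 : sqn x ≤ ∑ j : Fin d, ((m:ℝ)) ^ 2 := by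
      refine Finset.sum_le_sum fun j _ => ?_
      have e1 : -(m:ℝ) ≤ x j := by exact_mod_cast hx.1 j
      have e2 : (x j : ℝ) ≤ m := by exact_mod_cast hx.2 j
      exact sq_le_sq' e1 e2
    simp at h1
    have h2 : (d * (m:ℝ)) ^ 2 ≤ n ^ 2 := by gcongr
    have h3 : (d:ℝ) * m ^ 2 ≤ (d * (m:ℝ)) ^ 2 := by
      have : (d * (m:ℝ)) ^ 2 = d * (d * m ^ 2) := by ring
      rw [this]
      have : 0 ≤ (d:ℝ) * m ^ 2 := by positivity
      nlinarith
    linarith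
  have h1' : (2 * (m:ℝ) + 1) ^ d ≤ bn d n := by exact_mod_cast h1
  refine le_trans ?_ h1'
  have : (n:ℝ) / d ≤ 2 * m + 1 := by
    rw [div_le_iff₀ (by positivity)]
    have : (0:ℝ) ≤ m * d := by positivity
    nlinarith
  gcongr

open Classical in
/-- the shell `n - 1 < |x| ≤ n + 1` -/
noncomputable def shell (d n : ℕ) : Finset (V d) :=
  (ball d ((n + 1 : ℕ):ℝ)).filter (fun x => ((n:ℝ) - 1) ^ 2 < sqn x)

lemma mem_shell {d n : ℕ} (x : V d) :
    x ∈ shell d n ↔ sqn x ≤ ((n:ℝ) + 1) ^ 2 ∧ ((n:ℝ) - 1) ^ 2 < sqn x := by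
  unfold shell
  rw [Finset.mem_filter, mem_ball_iff]
  push_cast
  rfl

lemma sqn_subk {d : ℕ} (x : V d) (i : Fin d) (k : ℤ) :
    sqn (x - k • ev i) = sqn x - 2 * k * x i + k ^ 2 := by
  have := sqn_add x i (-k)
  rw [neg_smul, ← sub_eq_add_neg] at this
  rw [this]; push_cast; ring

lemma summable_shift {d : ℕ} {f : V d → ℝ} (hf : (Function.support f).Finite) (z : V d) :
    Summable fun x => f (x + z) := summable_of_hasFiniteSupport (fs_shift hf z)

lemma shell_card (d n : ℕ) (hd : 1 ≤ d) (hn : 36 * d ^ 2 ≤ n) :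
    ((shell d n).card : ℝ) * n ≤ 2 * d * (6 * d) ^ 2 * (3 * n) ^ d := by
  classical
  have hd' : (1:ℝ) ≤ d := by exact_mod_cast hd
  have hn' : 36 * (d:ℝ) ^ 2 ≤ n := by exact_mod_cast hn
  have hn1 : (36:ℝ) ≤ n := by nlinarith
  set ρ : ℝ := ((n:ℝ) - 1) ^ 2 with hρ
  set K : ℤ := 6 * d with hK
  have hKr : (K:ℝ) = 6 * d := by rw [hK]; push_cast; ring
  set v : V d → ℝ := fun x => max (ρ - sqn x) 0 with hv
  have hv0 : ∀ x, 0 ≤ v x := fun x => le_max_right _ _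
  have hv1 : ∀ x, ρ - sqn x ≤ v x := fun x => le_max_left _ _
  have hvz : ∀ x, ρ < sqn x → v x = 0 := fun x hx => max_eq_right (by linarith)
  have hfs : (Function.support v).Finite := by
    refine (ball d n).finite_toSet.subset fun x hx => ?_
    rw [Finset.mem_coe, mem_ball_iff]
    by_contra hcon
    push Not at hcon
    exact hx (hvz x (by nlinarith))
  set L : V d → ℝ := fun x => ∑ i, (v (x + K • ev i) + v (x - K • ev i) - 2 * v x) with hL
  have hsum : Summable L := by
    have hs : Summable v := summable_of_hasFiniteSupport hfs
    have e1 : ∀ i, Summable fun x => v (x + K • ev i) := fun i => summable_shift hfs _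
    have e2 : ∀ i, Summable fun x => v (x - K • ev i) := fun i => by
      simp_rw [sub_eq_add_neg]; exact summable_shift hfs _
    exact summable_sum fun i _ => ((e1 i).add (e2 i)).sub (hs.mul_left 2)
  have hzero : ∑' x, L x = 0 := by
    have := sbp K v (fun _ => 1) hfs
    simp only [one_mul] at this
    rw [hL, this]
    norm_num
  have hLpos : ∀ x, ρ < sqn x → 0 ≤ L x := by
    intro x hx
    refine Finset.sum_nonneg fun i _ => ?_
    rw [hvz x hx]
    linarith [hv0 (x + K • ev i), hv0 (x - K • ev i)]
  have hLneg : ∀ x, sqn x ≤ ρ → -(2 * d * (6 * d) ^ 2 : ℝ) ≤ L x := by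
    intro x hx
    have : ∑ i : Fin d, (-(2 * (6 * d) ^ 2) : ℝ) ≤ L x := by
      refine Finset.sum_le_sum fun i _ => ?_
      have h1 := hv1 (x + K • ev i)
      have h2 := hv1 (x - K • ev i)
      have h3 : v x = ρ - sqn x := max_eq_left (by linarith)
      rw [sqn_add] at h1
      rw [sqn_subk] at h2
      rw [h3, ← hKr]
      linarith
    simp at this
    linarith
  have hLsh : ∀ x ∈ shell d n, (n:ℝ) ≤ L x := by
    intro x hx
    rw [mem_shell] at hx
    have hxz := hvz x hx.2
    have hex : ∃ i, ((n:ℝ) - 1) ^ 2 / d ^ 2 ≤ (x i:ℝ) ^ 2 := by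
      by_contra hcon
      push Not at hcon
      have : sqn x ≤ ∑ i : Fin d, ((n:ℝ) - 1) ^ 2 / d ^ 2 :=
        Finset.sum_le_sum fun i _ => (hcon i).le
      simp at this
      have h2 : (d:ℝ) * (((n:ℝ) - 1) ^ 2 / d ^ 2) ≤ ((n:ℝ) - 1) ^ 2 := by
        rw [show (d:ℝ) * (((n:ℝ) - 1) ^ 2 / d ^ 2) = ((n:ℝ) - 1) ^ 2 / d by field_simp]
        exact div_le_self (by positivity) hd'
      linarith [hx.2]
    obtain ⟨i, hi⟩ := hex
    have hi2 : ((n:ℝ) - 1) / d ≤ |(x i:ℝ)| := by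
      rw [← div_pow] at hi
      exact (le_abs_self _).trans (sq_le_sq.1 hi)
    have hi3 : 6 * (n:ℝ) ≤ 2 * K * |(x i:ℝ)| := by
      rw [hKr]
      rw [div_le_iff₀ (by positivity)] at hi2
      nlinarith
    have hK2 : (K:ℝ) ^ 2 ≤ n := by rw [hKr]; nlinarith
    have hterm : (n:ℝ) ≤ v (x + K • ev i) + v (x - K • ev i) - 2 * v x := by
      have h1 := hv1 (x + K • ev i)
      have h2 := hv1 (x - K • ev i)
      have h3 := hv0 (x + K • ev i)
      have h4 := hv0 (x - K • ev i)
      rw [sqn_add] at h1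
      rw [sqn_subk] at h2
      rw [hxz]
      rcases abs_cases (x i : ℝ) with ⟨e, _⟩ | ⟨e, _⟩
      · rw [e] at hi3
        nlinarith [hx.1]
      · rw [e] at hi3
        nlinarith [hx.1]
    refine hterm.trans ?_
    refine Finset.single_le_sum (f := fun i => v (x + K • ev i) + v (x - K • ev i) - 2 * v x)
      (fun j _ => ?_) (Finset.mem_univ i)
    simp only [hxz]
    linarith [hv0 (x + K • ev j), hv0 (x - K • ev j)]
  set B' := (ball d n).filter (fun x => sqn x ≤ ρ) with hB'
  have hdis : Disjoint B' (shell d n) := by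
    rw [Finset.disjoint_left]
    intro x h1 h2
    have := (Finset.mem_filter.1 h1).2
    have := ((mem_shell x).1 h2).2
    linarith
  have hle := hsum.sum_le_tsum (B' ∪ shell d n) (fun x hx => by
    apply hLpos
    by_contra hcon
    push Not at hcon
    apply hx
    rw [Finset.mem_union]
    left
    rw [hB', Finset.mem_filter, mem_ball_iff]
    exact ⟨by nlinarith, hcon⟩)
  rw [hzero, Finset.sum_union hdis] at hle
  have h1 : ∑ x ∈ B', (-(2 * d * (6 * d) ^ 2 : ℝ)) ≤ ∑ x ∈ B', L x :=
    Finset.sum_le_sum fun x hx => hLneg x (Finset.mem_filter.1 hx).2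
  have h2 : ∑ x ∈ shell d n, (n:ℝ) ≤ ∑ x ∈ shell d n, L x := Finset.sum_le_sum hLsh
  rw [Finset.sum_const, nsmul_eq_mul] at h1 h2
  have h3 : (B'.card : ℝ) ≤ (3 * n) ^ d := by
    calc (B'.card : ℝ) ≤ (ball d n).card := by exact_mod_cast Finset.card_filter_le _ _
      _ ≤ (2 * n + 1) ^ d := bn_upper d n
      _ ≤ _ := by gcongr; linarith
  have h4 : (2 * d * (6 * d) ^ 2 : ℝ) * B'.card ≤ 2 * d * (6 * d) ^ 2 * (3 * n) ^ d := by gcongr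
  linarith


open MeasureTheory Filter
open scoped ENNReal

lemma nb_upper {d : ℕ} (x : V d) (i : Fin d) {r : ℝ} (hr : 0 ≤ r) (hx : sqn x ≤ r ^ 2) :
    sqn (x + ev i) ≤ (r + 1) ^ 2 ∧ sqn (x - ev i) ≤ (r + 1) ^ 2 := by
  have h1 : (x i:ℝ) ^ 2 ≤ r ^ 2 := (coord_sq_le x i).trans hx
  have h2 := abs_le_of_sq_le_sq' h1 hr
  rw [sqn_add_one, sqn_sub_one]
  constructor <;> nlinarith [h2.1, h2.2]

lemma nb_lower {d : ℕ} (x : V d) (i : Fin d) {r : ℝ} (hr : 1 ≤ r) (hx : r ^ 2 < sqn x) :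
    (r - 1) ^ 2 < sqn (x + ev i) ∧ (r - 1) ^ 2 < sqn (x - ev i) := by
  constructor
  · by_contra hcon
    push Not at hcon
    have := (nb_upper (x + ev i) i (by linarith) hcon).2
    rw [add_sub_cancel_right, sub_add_cancel] at this
    linarith
  · by_contra hcon
    push Not at hcon
    have := (nb_upper (x - ev i) i (by linarith) hcon).1
    rw [sub_add_cancel, sub_add_cancel] at this
    linarith

open Classical in
/-- the compactly supported test function -/
noncomputable def uf {d : ℕ} (Q : ℝ → ℝ) (n : ℕ) (x : V d) : ℝ :=
  if sqn x ≤ (n:ℝ) ^ 2 then Fr Q ((d:ℝ) / 2) n (sqn x) else 0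

/-- the normalising constant -/
noncomputable def cn (d n : ℕ) : ℝ := ((n:ℝ) ^ 2 + 2) ^ (-((d:ℝ) / 2))

open Classical in
/-- the defect -/
noncomputable def psi {d : ℕ} (Q : ℝ → ℝ) (n : ℕ) (x : V d) : ℝ :=
  (if x ∈ ball d n then 2 * d * cn d n else 0) - Lap (uf Q n) x

noncomputable def Cb (d : ℕ) : ℝ := 16 * ((d:ℝ) / 2) * (4:ℝ) ^ ((d:ℝ) / 2 + 1)

section
variable {Q : ℝ → ℝ} {d : ℕ}

lemma psi_interior (hQ : ∀ w, 0 < w → HasDerivAt Q (-(w ^ (-((d:ℝ) / 2)))) w) {n : ℕ} (hn : 4 ≤ n)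
    (x : V d) (hx : sqn x ≤ ((n:ℝ) - 1) ^ 2) :
    |psi Q n x| ≤ Cin d * (sqn x + 2) ^ (-((d:ℝ) / 2) - 1) := by
  have hn' : (4:ℝ) ≤ n := by exact_mod_cast hn
  have hx2 : sqn x ≤ (n:ℝ) ^ 2 := by nlinarith
  have hkey : Lap (uf Q n) x = 2 * d * cn d n +
      ∑ i, (Q (sqn x + 2 + 1 + 2 * x i) + Q (sqn x + 2 + 1 - 2 * x i) - 2 * Q (sqn x + 2)) := by
    have : ∀ i, uf Q n (x + ev i) + uf Q n (x - ev i) - 2 * uf Q n x = 2 * cn d n +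
        (Q (sqn x + 2 + 1 + 2 * x i) + Q (sqn x + 2 + 1 - 2 * x i) - 2 * Q (sqn x + 2)) := by
      intro i
      have h1 := nb_upper x i (by linarith) hx
      rw [sub_add_cancel] at h1
      unfold uf
      rw [if_pos h1.1, if_pos h1.2, if_pos hx2, sqn_add_one, sqn_sub_one]
      unfold Fr cn
      rw [show sqn x + 2 * x i + 1 + 2 = sqn x + 2 + 1 + 2 * x i by ring,
        show sqn x - 2 * x i + 1 + 2 = sqn x + 2 + 1 - 2 * x i by ring]
      ring
    unfold Lap
    rw [Finset.sum_congr rfl fun i _ => this i, Finset.sum_add_distrib]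
    simp
    ring
  unfold psi
  rw [if_pos ((mem_ball_iff n x).2 hx2), hkey, sub_add_cancel_left, abs_neg]
  exact Q_interior rfl hQ x

lemma uf_bound (hQ : ∀ w, 0 < w → HasDerivAt Q (-(w ^ (-((d:ℝ) / 2)))) w) {n : ℕ} (hn : 4 ≤ n)
    (x : V d) (hx : ((n:ℝ) - 2) ^ 2 ≤ sqn x) :
    |uf Q n x| ≤ Cb d * ((n:ℝ) ^ 2) ^ (-((d:ℝ) / 2)) := by
  unfold uf Cb
  split_ifs with h
  · exact Fr_boundary (by positivity) hQ hn hx h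
  · rw [abs_zero]; positivity

lemma psi_shell (hQ : ∀ w, 0 < w → HasDerivAt Q (-(w ^ (-((d:ℝ) / 2)))) w) {n : ℕ} (hn : 4 ≤ n)
    (x : V d) (hx : ((n:ℝ) - 1) ^ 2 < sqn x) :
    |psi Q n x| ≤ (2 * d + 4 * d * Cb d) * ((n:ℝ) ^ 2) ^ (-((d:ℝ) / 2)) := by
  have hn' : (4:ℝ) ≤ n := by exact_mod_cast hn
  set W := ((n:ℝ) ^ 2) ^ (-((d:ℝ) / 2)) with hW
  have hW0 : 0 ≤ W := by positivity
  have h1 : |(if x ∈ ball d n then 2 * d * cn d n else 0 : ℝ)| ≤ 2 * d * W := by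
    have hc : cn d n ≤ W := rpow_anti (by positivity) (by linarith) (by
      have : (0:ℝ) ≤ d := by positivity
      linarith)
    have hc0 : 0 ≤ cn d n := by unfold cn; positivity
    split_ifs
    · rw [abs_of_nonneg (by positivity)]; gcongr
    · rw [abs_zero]; positivity
  have h2 : |Lap (uf Q n) x| ≤ 4 * d * Cb d * W := by
    unfold Lap
    refine (Finset.abs_sum_le_sum_abs _ _).trans ?_
    have : ∀ i ∈ (Finset.univ : Finset (Fin d)),
        |uf Q n (x + ev i) + uf Q n (x - ev i) - 2 * uf Q n x| ≤ 4 * (Cb d * W) := by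
      intro i _
      have hl := nb_lower x i (by linarith) hx
      rw [show (n:ℝ) - 1 - 1 = n - 2 by ring] at hl
      have e1 := abs_le.1 (uf_bound hQ hn _ hl.1.le)
      have e2 := abs_le.1 (uf_bound hQ hn _ hl.2.le)
      have e3 := abs_le.1 (uf_bound hQ hn x (by nlinarith))
      rw [abs_le]
      constructor <;> linarith
    refine (Finset.sum_le_sum this).trans (le_of_eq ?_)
    simp
    ring
  unfold psi
  refine (abs_sub _ _).trans ?_
  convert add_le_add h1 h2 using 1
  ring

lemma Lap_uf_zero (n : ℕ) (x : V d) (hx : ((n:ℝ) + 1) ^ 2 < sqn x) :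
    Lap (uf Q n) x = 0 := by
  unfold Lap
  refine Finset.sum_eq_zero fun i _ => ?_
  have h1 := nb_lower x i (r := (n:ℝ) + 1) (by linarith [Nat.cast_nonneg (α := ℝ) n]) hx
  rw [add_sub_cancel_right] at h1
  unfold uf
  rw [if_neg (by linarith [h1.1]), if_neg (by linarith [h1.2]), if_neg]
  · ring
  · have : (0:ℝ) ≤ n := by positivity
    nlinarith

lemma uf_supp (n : ℕ) : (Function.support (uf (d := d) Q n)).Finite := by
  refine (ball d n).finite_toSet.subset fun x hx => ?_
  rw [Finset.mem_coe, mem_ball_iff]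
  by_contra hcon
  exact hx (if_neg hcon)

lemma sum_Lap_uf (n : ℕ) (h : V d → ℝ) (hh : ∀ x ∈ ball d n, Lap h x = 0) :
    ∑ x ∈ ball d ((n + 1 : ℕ):ℝ), h x * Lap (uf Q n) x = 0 := by
  have h1 := sbp 1 (uf Q n) h (uf_supp n)
  simp only [one_smul] at h1
  have h2 : ∑' x, uf Q n x * Lap h x = 0 := by
    rw [← tsum_zero (α := ℝ) (β := V d)]
    congr 1
    ext x
    by_cases hx : x ∈ ball d n
    · rw [hh x hx, mul_zero]
    · rw [mem_ball_iff] at hx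
      unfold uf
      rw [if_neg hx, zero_mul]
  rw [← h2]
  unfold Lap
  rw [← h1]
  symm
  apply tsum_eq_sum
  intro x hx
  rw [mem_ball_iff] at hx
  push Not at hx
  push_cast at hx
  have := Lap_uf_zero (Q := Q) n x hx
  unfold Lap at this
  rw [this, mul_zero]

lemma psi_identity (n : ℕ) (h : V d → ℝ) (hh : ∀ x ∈ ball d n, Lap h x = 0) :
    ∑ x ∈ ball d ((n + 1 : ℕ):ℝ), psi Q n x * (h 0 - h x) =
      2 * d * cn d n * (bn d n * h 0 - ∑ x ∈ ball d n, h x) := by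
  classical
  have h1 := sum_Lap_uf (Q := Q) n h hh
  have h2 := sum_Lap_uf (Q := Q) n (fun _ : V d => h 0) (fun x _ => by unfold Lap; norm_num; ring)
  have hsub : ball d n ⊆ ball d ((n + 1 : ℕ):ℝ) := by
    intro x hx
    rw [mem_ball_iff] at hx ⊢
    push_cast
    have : (0:ℝ) ≤ n := by positivity
    nlinarith
  have h3 : ∑ x ∈ ball d ((n + 1 : ℕ):ℝ), (if x ∈ ball d n then 2 * d * cn d n * (h 0 - h x) else 0) =
      2 * d * cn d n * (bn d n * h 0 - ∑ x ∈ ball d n, h x) := by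
    rw [Finset.sum_ite_mem, Finset.inter_eq_right.2 hsub, ← Finset.mul_sum, Finset.sum_sub_distrib]
    simp [bn]
  rw [← h3]
  have h4 : ∀ x, psi Q n x * (h 0 - h x) = (if x ∈ ball d n then 2 * d * cn d n * (h 0 - h x) else 0)
      - h 0 * Lap (uf Q n) x + h x * Lap (uf Q n) x := by
    intro x
    unfold psi
    split_ifs <;> ring
  rw [Finset.sum_congr rfl fun x _ => h4 x, Finset.sum_add_distrib, Finset.sum_sub_distrib, h1, h2]
  ring

end

theorem det_thm (d : ℕ) (hd : 1 ≤ d) : ∃ C : ℝ, 0 < C ∧ ∀ n : ℕ, 1 ≤ n → ∀ h : V d → ℝ,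
    (∀ x, |h x| ≤ 1) → (∀ x ∈ ball d n, Lap h x = 0) →
    |h 0 - (1/(bn d n:ℝ)) * ∑ x ∈ ball d n, h x| ≤ C / n := by
  classical
  have hd' : (1:ℝ) ≤ d := by exact_mod_cast hd
  obtain ⟨Q, hQ⟩ := exists_Q ((d:ℝ) / 2)
  obtain ⟨S, hS0, hS⟩ := sum_bound d hd
  set K : ℝ := 4 * d ^ 2 * (d + 1) with hK
  set D : ℝ := 2 * d + 4 * d * Cb d with hD
  have hCb : 0 ≤ Cb d := by unfold Cb; positivity
  have hCin : 0 ≤ Cin d := by unfold Cin; positivity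
  have hD0 : 0 ≤ D := by positivity
  have hK0 : 0 ≤ K := by positivity
  set R : ℝ := Cin d * K * S + 2 * D * (2 * d * (6 * d) ^ 2 * 3 ^ d) with hR
  have hR0 : 0 ≤ R := by positivity
  refine ⟨R * ((3:ℝ) ^ ((d:ℝ) / 2) * d ^ d) + 2 * (36 * d ^ 2) + 1, by positivity, ?_⟩
  intro n hn h hb hh
  have hn' : (1:ℝ) ≤ n := by exact_mod_cast hn
  have hbn := bn_lower d n hd
  have hbpos : (0:ℝ) < bn d n := lt_of_lt_of_le (by positivity) hbn
  by_cases hsmall : n < 36 * d ^ 2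
  · have hs' : (n:ℝ) ≤ 36 * d ^ 2 := by exact_mod_cast hsmall.le
    have h1 : |∑ x ∈ ball d n, h x| ≤ bn d n := by
      refine (Finset.abs_sum_le_sum_abs _ _).trans ?_
      refine (Finset.sum_le_sum fun x _ => hb x).trans (le_of_eq ?_)
      simp [bn]
    have h2 : |(1/(bn d n:ℝ)) * ∑ x ∈ ball d n, h x| ≤ 1 := by
      rw [abs_mul, abs_of_pos (by positivity), one_div, inv_mul_le_iff₀ hbpos, mul_one]
      exact h1
    have h3 : |h 0 - (1/(bn d n:ℝ)) * ∑ x ∈ ball d n, h x| ≤ 2 := by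
      refine (abs_sub _ _).trans ?_
      linarith [hb 0]
    refine h3.trans ?_
    rw [le_div_iff₀ (by positivity)]
    have : 0 ≤ R * ((3:ℝ) ^ ((d:ℝ) / 2) * d ^ d) := by positivity
    linarith
  push Not at hsmall
  have hn4 : 4 ≤ n := by nlinarith
  have hn4' : (4:ℝ) ≤ n := by exact_mod_cast hn4
  set W := ((n:ℝ) ^ 2) ^ (-((d:ℝ) / 2)) with hW
  have hWn : W * (n:ℝ) ^ d = 1 := by
    have : W = ((n:ℝ) ^ d)⁻¹ := by
      rw [hW, ← Real.rpow_natCast, ← Real.rpow_mul (by positivity), ← Real.rpow_natCast,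
        ← Real.rpow_neg (by positivity)]
      congr 1
      push_cast; ring
    rw [this, inv_mul_cancel₀ (by positivity)]
  have hW0 : 0 ≤ W := by positivity
  have hlip := lip hd h hb n hn hh
  have hpt : ∀ x ∈ ball d ((n + 1 : ℕ):ℝ), |psi Q n x * (h 0 - h x)| ≤
      Cin d * K / n * (sqn x + 2) ^ (-((d:ℝ) / 2) - 1 / 2) +
        (if x ∈ shell d n then D * W * 2 else 0) := by
    intro x hx
    have hs := sqn_nonneg x
    have hq0 : 0 ≤ (sqn x + 2) ^ (-((d:ℝ) / 2) - 1 / 2) := Real.rpow_nonneg (by linarith) _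
    rw [abs_mul]
    by_cases hc : sqn x ≤ ((n:ℝ) - 1) ^ 2
    · have hns : x ∉ shell d n := fun hcon => by
        have := ((mem_shell x).1 hcon).2
        linarith
      rw [if_neg hns, add_zero]
      have h1 := psi_interior hQ hn4 x hc
      have h2 := hlip x
      rw [abs_sub_comm] at h2
      have h3 : Real.sqrt (sqn x) ≤ (sqn x + 2) ^ (1 / 2 : ℝ) := by
        rw [← Real.sqrt_eq_rpow]
        exact Real.sqrt_le_sqrt (by linarith)
      have h4 : (sqn x + 2) ^ (-((d:ℝ) / 2) - 1 / 2) =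
          (sqn x + 2) ^ (-((d:ℝ) / 2) - 1) * (sqn x + 2) ^ (1 / 2 : ℝ) := by
        rw [← Real.rpow_add (by linarith)]
        congr 1
        ring
      have hq1 : 0 ≤ (sqn x + 2) ^ (-((d:ℝ) / 2) - 1) := Real.rpow_nonneg (by linarith) _
      rw [h4]
      calc _ ≤ (Cin d * (sqn x + 2) ^ (-((d:ℝ) / 2) - 1)) * (K / n * (sqn x + 2) ^ (1 / 2 : ℝ)) := by
            apply mul_le_mul h1 _ (abs_nonneg _) (by positivity)
            refine h2.trans ?_
            gcongr
        _ = _ := by ring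
    · push Not at hc
      have hxs : x ∈ shell d n := by
        rw [mem_shell]
        rw [mem_ball_iff] at hx
        push_cast at hx
        exact ⟨hx, hc⟩
      rw [if_pos hxs]
      have h1 := psi_shell hQ hn4 x hc
      have h2 : |h 0 - h x| ≤ 2 := (abs_sub _ _).trans (by linarith [hb 0, hb x])
      have h3 : |psi Q n x| * |h 0 - h x| ≤ D * W * 2 := mul_le_mul h1 h2 (abs_nonneg _) (by positivity)
      have : 0 ≤ Cin d * K / n * (sqn x + 2) ^ (-((d:ℝ) / 2) - 1 / 2) := by positivity
      linarith
  have htot : |2 * d * cn d n * (bn d n * h 0 - ∑ x ∈ ball d n, h x)| ≤ R / n := by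
    rw [← psi_identity (Q := Q) n h hh]
    refine (Finset.abs_sum_le_sum_abs _ _).trans ((Finset.sum_le_sum hpt).trans ?_)
    rw [Finset.sum_add_distrib, ← Finset.mul_sum, Finset.sum_ite_mem, Finset.sum_const, nsmul_eq_mul]
    have h1 := hS (ball d ((n + 1 : ℕ):ℝ))
    have h2 : ((ball d ((n + 1 : ℕ):ℝ) ∩ shell d n).card : ℝ) ≤ (shell d n).card := by
      exact_mod_cast Finset.card_le_card Finset.inter_subset_right
    have h3 := shell_card d n hd hsmall
    have h4 : ((shell d n).card : ℝ) * (D * W * 2) ≤ 2 * D * (2 * d * (6 * d) ^ 2 * 3 ^ d) / n := by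
      rw [le_div_iff₀ (by positivity)]
      calc ((shell d n).card : ℝ) * (D * W * 2) * n = ((shell d n).card * n) * (D * W * 2) := by ring
        _ ≤ (2 * d * (6 * d) ^ 2 * (3 * n) ^ d) * (D * W * 2) := by gcongr
        _ = 2 * D * (2 * d * (6 * d) ^ 2 * 3 ^ d) * (W * n ^ d) := by rw [mul_pow]; ring
        _ = _ := by rw [hWn, mul_one]
    calc _ ≤ Cin d * K / n * S + (shell d n).card * (D * W * 2) := by gcongr
      _ ≤ Cin d * K / n * S + 2 * D * (2 * d * (6 * d) ^ 2 * 3 ^ d) / n := by gcongr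
      _ = R / n := by rw [hR]; ring
  have hlow : 1 ≤ 2 * d * cn d n * bn d n * ((3:ℝ) ^ ((d:ℝ) / 2) * d ^ d) := by
    have h1 : (3:ℝ) ^ (-((d:ℝ) / 2)) * W ≤ cn d n := by
      rw [hW, ← Real.mul_rpow (by norm_num) (by positivity)]
      exact rpow_anti (by positivity) (by nlinarith) (by linarith)
    have h0 : 0 ≤ cn d n := by unfold cn; positivity
    have h3 : (3:ℝ) ^ (-((d:ℝ) / 2)) * (3:ℝ) ^ ((d:ℝ) / 2) = 1 := by
      rw [← Real.rpow_add (by norm_num)]; simp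
    have h2 : 1 ≤ cn d n * bn d n * ((3:ℝ) ^ ((d:ℝ) / 2) * d ^ d) := by
      calc (1:ℝ) = ((3:ℝ) ^ (-((d:ℝ) / 2)) * (3:ℝ) ^ ((d:ℝ) / 2)) * (W * n ^ d) := by rw [h3, hWn, one_mul]
        _ = ((3:ℝ) ^ (-((d:ℝ) / 2)) * W) * ((n:ℝ) / d) ^ d * ((3:ℝ) ^ ((d:ℝ) / 2) * d ^ d) := by
            rw [div_pow]; field_simp
        _ ≤ _ := by gcongr
    nlinarith
  have hc0 : 0 < 2 * d * cn d n := by unfold cn; positivity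
  rw [abs_mul, abs_of_pos hc0] at htot
  have e : h 0 - (1/(bn d n:ℝ)) * ∑ x ∈ ball d n, h x =
      (bn d n * h 0 - ∑ x ∈ ball d n, h x) / bn d n := by field_simp
  rw [e, abs_div, abs_of_pos hbpos]
  set Y := |bn d n * h 0 - ∑ x ∈ ball d n, h x| with hY
  set G := (3:ℝ) ^ ((d:ℝ) / 2) * d ^ d with hG
  have hG0 : 0 ≤ G := by positivity
  have h1 : Y / bn d n ≤ R * G / n := by
    rw [div_le_iff₀ hbpos]
    calc Y = Y * 1 := by ring
      _ ≤ Y * (2 * d * cn d n * bn d n * G) := by gcongr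
      _ = (2 * d * cn d n * Y) * (bn d n * G) := by ring
      _ ≤ R / n * (bn d n * G) := by gcongr
      _ = _ := by ring
  refine h1.trans ?_
  gcongr
  have : (0:ℝ) ≤ 2 * (36 * d ^ 2) := by positivity
  linarith


theorem statement4 (d : ℕ) (hd : 2 ≤ d) :
    ∃ C : ℝ, 0 < C ∧ ∀ n : ℕ, 1 ≤ n → ∀ A : Finset (V d), ball d n ⊆ A →
      ∑ y ∈ outb A,
        |(hitProb A 0 y).toReal -
          (1 / (bn d n : ℝ)) * ∑ x ∈ ball d n, (hitProb A x y).toReal| ≤ C / n :=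
  statement4_of_det d hd (det_thm d (by omega))
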